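/- Let Δ ⊂ ℝ² be a 2-dimensional lattice polytope which is maximal and nonhyperelliptic. Then r − r^{(1)} = 9 (where r and r^{(1)} are the numbers of boundary lattice points of Δ and of Δ^{(1)}) if and only if Δ is equivalent to dΣ for some integer d ≥ 4, where Σ = conv{(0,0),(1,0),(0,1)} is the standard 2-simplex. -/

import Mathlib

noncomputable section

/-- The embedding of the integer lattice `ℤ²` into the plane `ℝ²`. -/
def toR2 (p : ℤ × ℤ) : ℝ × ℝ := ((p.1 : ℝ), (p.2 : ℝ))

/-- A lattice polytope in `ℝ²`: the convex hull of a finite set of lattice points. -/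
def IsLatticePolytope (Δ : Set (ℝ × ℝ)) : Prop :=
  ∃ S : Finset (ℤ × ℤ), Δ = convexHull ℝ (toR2 '' (S : Set (ℤ × ℤ)))

/-- The lattice points of `Δ`. -/
def latticePts (Δ : Set (ℝ × ℝ)) : Set (ℤ × ℤ) := {p | toR2 p ∈ Δ}

/-- The interior lattice points of `Δ`. -/
def intPts (Δ : Set (ℝ × ℝ)) : Set (ℤ × ℤ) := {p | toR2 p ∈ interior Δ}

/-- The boundary lattice points of `Δ`. -/
def bdPts (Δ : Set (ℝ × ℝ)) : Set (ℤ × ℤ) := {p | toR2 p ∈ frontier Δ}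

/-- `Δ⁽¹⁾`: the convex hull of the interior lattice points of `Δ`. -/
def interiorHull (Δ : Set (ℝ × ℝ)) : Set (ℝ × ℝ) := convexHull ℝ (toR2 '' intPts Δ)

/-- `Δ` is maximal: any lattice polytope strictly containing `Δ` has a different set of
interior lattice points. -/
def IsMaximalPolytope (Δ : Set (ℝ × ℝ)) : Prop :=
  ∀ Δ' : Set (ℝ × ℝ), IsLatticePolytope Δ' → Δ ⊂ Δ' → intPts Δ' ≠ intPts Δ

/-- `Δ` is hyperelliptic: its interior lattice points are collinear. -/
def IsHyperelliptic (Δ : Set (ℝ × ℝ)) : Prop := Collinear ℝ (toR2 '' intPts Δ)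

/-- A facet (edge) of `Δ`: a one-dimensional exposed face. -/
def IsFacet (Δ τ : Set (ℝ × ℝ)) : Prop :=
  IsExposed ℝ Δ τ ∧ Collinear ℝ τ ∧ ¬ τ.Subsingleton

/-- `v` is a column vector of `Δ`: `v ≠ 0` and there is a facet `τ` (the base facet)
such that `v + ((Δ ∖ τ) ∩ ℤ²) ⊆ Δ`. -/
def IsColumnVector (Δ : Set (ℝ × ℝ)) (v : ℤ × ℤ) : Prop :=
  v ≠ 0 ∧ ∃ τ : Set (ℝ × ℝ), IsFacet Δ τ ∧
    ∀ p : ℤ × ℤ, toR2 p ∈ Δ \ τ → toR2 (p + v) ∈ Δ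

/-- `c(Δ)`: the number of column vectors of `Δ`. -/
def colCount (Δ : Set (ℝ × ℝ)) : ℕ := {v : ℤ × ℤ | IsColumnVector Δ v}.ncard

/-- Two lattice polytopes are equivalent if one is the image of the other under an
affine map `v ↦ Av + b` with `A ∈ GL₂(ℤ)` and `b ∈ ℤ²`. -/
def PolytopeEquiv (Δ Δ' : Set (ℝ × ℝ)) : Prop :=
  ∃ a b c d e f : ℤ, (a * d - b * c = 1 ∨ a * d - b * c = -1) ∧
    (fun q : ℝ × ℝ =>
      ((a : ℝ) * q.1 + (b : ℝ) * q.2 + (e : ℝ),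
       (c : ℝ) * q.1 + (d : ℝ) * q.2 + (f : ℝ))) '' Δ = Δ'

/-- The `d`-fold dilation `dΣ = conv{(0,0),(d,0),(0,d)}` of the standard 2-simplex. -/
def stdSimplexD (d : ℕ) : Set (ℝ × ℝ) :=
  convexHull ℝ ({((0 : ℝ), (0 : ℝ)), ((d : ℝ), 0), (0, (d : ℝ))} : Set (ℝ × ℝ))

/-- The value of the integral linear functional `w` at the lattice point `x`. -/
def pair (w x : ℤ × ℤ) : ℤ := w.1 * x.1 + w.2 * x.2

/-- `u` and `v` form a basis of `ℤ²`. -/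
def IsBasisPair (u v : ℤ × ℤ) : Prop :=
  u.1 * v.2 - u.2 * v.1 = 1 ∨ u.1 * v.2 - u.2 * v.1 = -1

@[simp] lemma pair_add_left (u v x : ℤ × ℤ) : pair (u + v) x = pair u x + pair v x := by
  simp only [pair, Prod.fst_add, Prod.snd_add]; ring

@[simp] lemma pair_neg_left (u x : ℤ × ℤ) : pair (-u) x = -pair u x := by
  simp only [pair, Prod.fst_neg, Prod.snd_neg]; ring

@[simp] lemma pair_sub_left (u v x : ℤ × ℤ) : pair (u - v) x = pair u x - pair v x := by
  simp only [pair, Prod.fst_sub, Prod.snd_sub]; ring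

@[simp] lemma pair_smul_left (k : ℤ) (u x : ℤ × ℤ) : pair (k • u) x = k * pair u x := by
  simp only [pair, Prod.smul_fst, Prod.smul_snd, smul_eq_mul]; ring

@[simp] lemma pair_add_right (u x y : ℤ × ℤ) : pair u (x + y) = pair u x + pair u y := by
  simp only [pair, Prod.fst_add, Prod.snd_add]; ring

@[simp] lemma pair_sub_right (u x y : ℤ × ℤ) : pair u (x - y) = pair u x - pair u y := by
  simp only [pair, Prod.fst_sub, Prod.snd_sub]; ring

@[simp] lemma pair_smul_right (k : ℤ) (u x : ℤ × ℤ) : pair u (k • x) = k * pair u x := by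
  simp only [pair, Prod.smul_fst, Prod.smul_snd, smul_eq_mul]; ring

namespace IsBasisPair

variable {u v : ℤ × ℤ}

lemma symm (h : IsBasisPair u v) : IsBasisPair v u := by
  unfold IsBasisPair at *; grind

lemma add_right (h : IsBasisPair u v) : IsBasisPair u (u + v) := by
  unfold IsBasisPair at *; simp only [Prod.fst_add, Prod.snd_add]; grind

lemma add_left (h : IsBasisPair u v) : IsBasisPair (u + v) v := by
  unfold IsBasisPair at *; simp only [Prod.fst_add, Prod.snd_add]; grind

lemma neg_right (h : IsBasisPair u v) : IsBasisPair u (-v) := by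
  unfold IsBasisPair at *; simp only [Prod.fst_neg, Prod.snd_neg]; grind

lemma isCoprime (h : IsBasisPair u v) : IsCoprime u.1 u.2 := by
  rcases h with h | h
  · exact ⟨v.2, -v.1, by linarith⟩
  · exact ⟨-v.2, v.1, by linarith⟩

lemma exists_pair_eq (h : IsBasisPair u v) (a b : ℤ) : ∃ z, pair u z = a ∧ pair v z = b := by
  rcases h with h | h
  · refine ⟨(a * v.2 - b * u.2, b * u.1 - a * v.1), ?_, ?_⟩ <;> simp only [pair]
    · linear_combination a * h
    · linear_combination b * h
  · refine ⟨(b * u.2 - a * v.2, a * v.1 - b * u.1), ?_, ?_⟩ <;> simp only [pair]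
    · linear_combination -a * h
    · linear_combination -b * h

lemma ext (h : IsBasisPair u v) {x y : ℤ × ℤ} (hu : pair u x = pair u y)
    (hv : pair v x = pair v y) : x = y := by
  simp only [pair] at hu hv
  rcases h with h | h
  · ext
    · linear_combination v.2 * hu - u.2 * hv - (x.1 - y.1) * h
    · linear_combination u.1 * hv - v.1 * hu - (x.2 - y.2) * h
  · ext
    · linear_combination u.2 * hv - v.2 * hu + (x.1 - y.1) * h
    · linear_combination v.1 * hu - u.1 * hv + (x.2 - y.2) * h

end IsBasisPair

/-- The minimum of the functional `w` on the finite set `A`. -/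
def supp (A : Finset (ℤ × ℤ)) (w : ℤ × ℤ) : ℤ := sInf (pair w '' (A : Set (ℤ × ℤ)))

/-- The points of `A` at which the functional `w` is minimal. -/
def face (A : Finset (ℤ × ℤ)) (w : ℤ × ℤ) : Finset (ℤ × ℤ) :=
  A.filter fun x => pair w x = supp A w

/-- The minimum of the functional `z` on the face of `A` given by `w`. -/
def lo (A : Finset (ℤ × ℤ)) (w z : ℤ × ℤ) : ℤ := supp (face A w) z

/-- The maximum of the functional `z` on the face of `A` given by `w`. -/
def hi (A : Finset (ℤ × ℤ)) (w z : ℤ × ℤ) : ℤ := -supp (face A w) (-z)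

/-- `A` contains all lattice points on segments between its points. -/
def LatticeConvex (A : Finset (ℤ × ℤ)) : Prop :=
  ∀ x ∈ A, ∀ y ∈ A, ∀ (z : ℤ × ℤ) (m n : ℤ), 0 ≤ m → 0 ≤ n → 0 < m + n →
    (m + n) • z = m • x + n • y → z ∈ A

section supp

variable {A : Finset (ℤ × ℤ)} {w x z u v : ℤ × ℤ}

lemma supp_le (hx : x ∈ A) : supp A w ≤ pair w x :=
  csInf_le (A.finite_toSet.image _).bddBelow ⟨x, hx, rfl⟩

lemma exists_eq_supp (hA : A.Nonempty) (w : ℤ × ℤ) : ∃ x ∈ A, pair w x = supp A w := by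
  have h : (pair w '' (A : Set (ℤ × ℤ))).Nonempty := hA.to_set.image _
  obtain ⟨x, hx, h⟩ := Int.csInf_mem h (A.finite_toSet.image _).bddBelow
  exact ⟨x, hx, h⟩

lemma le_supp (hA : A.Nonempty) {c : ℤ} (h : ∀ x ∈ A, c ≤ pair w x) : c ≤ supp A w := by
  obtain ⟨x, hx, e⟩ := exists_eq_supp hA w
  exact e ▸ h x hx

lemma mem_face : x ∈ face A w ↔ x ∈ A ∧ pair w x = supp A w := by simp [face]

lemma face_nonempty (hA : A.Nonempty) (w : ℤ × ℤ) : (face A w).Nonempty := by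
  obtain ⟨x, hx, e⟩ := exists_eq_supp hA w
  exact ⟨x, mem_face.2 ⟨hx, e⟩⟩

lemma supp_add_le (hA : A.Nonempty) (u v : ℤ × ℤ) : supp A u + supp A v ≤ supp A (u + v) :=
  le_supp hA fun x hx => by
    rw [pair_add_left]; exact add_le_add (supp_le hx) (supp_le hx)

lemma lo_le (hx : x ∈ face A w) : lo A w z ≤ pair z x := supp_le hx

lemma le_hi (hx : x ∈ face A w) : pair z x ≤ hi A w z := by
  have := supp_le (w := -z) hx
  rw [pair_neg_left] at this
  unfold hi; linarith

lemma exists_eq_lo (hA : A.Nonempty) (w z : ℤ × ℤ) : ∃ x ∈ face A w, pair z x = lo A w z :=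
  exists_eq_supp (face_nonempty hA w) z

lemma exists_eq_hi (hA : A.Nonempty) (w z : ℤ × ℤ) : ∃ x ∈ face A w, pair z x = hi A w z := by
  obtain ⟨x, hx, e⟩ := exists_eq_supp (face_nonempty hA w) (-z)
  refine ⟨x, hx, ?_⟩
  rw [pair_neg_left] at e
  unfold hi; linarith

lemma supp_le_lo (hA : A.Nonempty) (w z : ℤ × ℤ) : supp A z ≤ lo A w z := by
  obtain ⟨x, hx, e⟩ := exists_eq_lo hA w z
  exact e ▸ supp_le (mem_face.1 hx).1

lemma lo_le_hi (hA : A.Nonempty) (w z : ℤ × ℤ) : lo A w z ≤ hi A w z := by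
  obtain ⟨x, hx, e⟩ := exists_eq_lo hA w z
  exact e ▸ le_hi hx

/-- Changing the functional by a multiple of the one that is constant on the face. -/
lemma hi_eq_of_add (hA : A.Nonempty) {k : ℤ} {y : ℤ × ℤ} (h : y = k • w + z) :
    hi A w y = k * supp A w + hi A w z := by
  subst h
  apply le_antisymm
  · obtain ⟨x, hx, e⟩ := exists_eq_hi hA w (k • w + z)
    rw [← e, pair_add_left, pair_smul_left, (mem_face.1 hx).2]
    linarith [le_hi (z := z) hx]
  · obtain ⟨x, hx, e⟩ := exists_eq_hi hA w z
    have := le_hi (z := k • w + z) hx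
    rw [pair_add_left, pair_smul_left, (mem_face.1 hx).2] at this
    linarith

lemma hi_eq_of_sub (hA : A.Nonempty) {k : ℤ} {y : ℤ × ℤ} (h : y = k • w - z) :
    hi A w y = k * supp A w - lo A w z := by
  subst h
  apply le_antisymm
  · obtain ⟨x, hx, e⟩ := exists_eq_hi hA w (k • w - z)
    rw [← e, pair_sub_left, pair_smul_left, (mem_face.1 hx).2]
    linarith [lo_le (z := z) hx]
  · obtain ⟨x, hx, e⟩ := exists_eq_lo hA w z
    have := le_hi (z := k • w - z) hx
    rw [pair_sub_left, pair_smul_left, (mem_face.1 hx).2] at this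
    linarith

lemma lo_eq_of_add (hA : A.Nonempty) {k : ℤ} {y : ℤ × ℤ} (h : y = k • w + z) :
    lo A w y = k * supp A w + lo A w z := by
  subst h
  apply le_antisymm
  · obtain ⟨x, hx, e⟩ := exists_eq_lo hA w z
    have := lo_le (z := k • w + z) hx
    rw [pair_add_left, pair_smul_left, (mem_face.1 hx).2] at this
    linarith
  · obtain ⟨x, hx, e⟩ := exists_eq_lo hA w (k • w + z)
    rw [← e, pair_add_left, pair_smul_left, (mem_face.1 hx).2]
    linarith [lo_le (z := z) hx]

lemma card_face (hA : A.Nonempty) (hc : LatticeConvex A) (h : IsBasisPair w z) :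
    ((face A w).card : ℤ) = hi A w z - lo A w z + 1 := by
  have himg : (face A w).image (pair z) = Finset.Icc (lo A w z) (hi A w z) := by
    ext k
    simp only [Finset.mem_image, Finset.mem_Icc]
    constructor
    · rintro ⟨x, hx, rfl⟩
      exact ⟨lo_le hx, le_hi hx⟩
    · rintro ⟨h1, h2⟩
      obtain ⟨x, hx, ex⟩ := exists_eq_lo hA w z
      obtain ⟨y, hy, ey⟩ := exists_eq_hi hA w z
      obtain ⟨p, hp, hk⟩ := h.exists_pair_eq (supp A w) k
      refine ⟨p, mem_face.2 ⟨?_, hp⟩, hk⟩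
      rw [mem_face] at hx hy
      rcases (h1.trans h2).eq_or_lt with he | hlt
      · have : p = x := h.ext (hp.trans hx.2.symm) (by omega)
        exact this ▸ hx.1
      · refine hc x hx.1 y hy.1 p (hi A w z - k) (k - lo A w z) (by omega) (by omega) (by omega)
          (h.ext ?_ ?_)
        · simp only [pair_add_right, pair_smul_right, hp, hx.2, hy.2]; ring
        · simp only [pair_add_right, pair_smul_right, hk, ex, ey]; ring
  have hinj : Set.InjOn (pair z) (face A w) := fun x hx y hy e =>
    h.ext ((mem_face.1 hx).2.trans (mem_face.1 hy).2.symm) e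
  rw [← Finset.card_image_of_injOn hinj, himg, Int.card_Icc]
  have := lo_le_hi hA w z
  omega

end supp

/-- The real functional with coefficients `a`, `b` attains its minimum over `A` at `q`. -/
def IsMinAt (A : Finset (ℤ × ℤ)) (q : ℤ × ℤ) (a b : ℝ) : Prop :=
  ∀ x ∈ A, a * q.1 + b * q.2 ≤ a * x.1 + b * x.2

open Classical in
/-- The points of `A` minimizing some nonzero functional in the cone spanned by `u` and `v`. -/
def coneFace (A : Finset (ℤ × ℤ)) (u v : ℤ × ℤ) : Finset (ℤ × ℤ) :=
  A.filter fun q => ∃ s t : ℝ, 0 ≤ s ∧ 0 ≤ t ∧ 0 < s + t ∧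
    IsMinAt A q (s * u.1 + t * v.1) (s * u.2 + t * v.2)

open Classical in
/-- The points of `A` minimizing some nonzero functional. -/
def rim (A : Finset (ℤ × ℤ)) : Finset (ℤ × ℤ) :=
  A.filter fun q => ∃ a b : ℝ, (a ≠ 0 ∨ b ≠ 0) ∧ IsMinAt A q a b

/-- `A` is not contained in a line. -/
def Spread (A : Finset (ℤ × ℤ)) : Prop :=
  ∀ a b : ℝ, (∀ x ∈ A, ∀ y ∈ A, a * x.1 + b * x.2 = a * y.1 + b * y.2) → a = 0 ∧ b = 0

section coneFace

variable {A : Finset (ℤ × ℤ)} {q u v w : ℤ × ℤ} {a b c d : ℝ}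

lemma IsMinAt.add (h : IsMinAt A q a b) (h' : IsMinAt A q c d) : IsMinAt A q (a + c) (b + d) :=
  fun x hx => by linarith [h x hx, h' x hx]

lemma IsMinAt.smul (h : IsMinAt A q a b) (hc : 0 ≤ c) : IsMinAt A q (c * a) (c * b) :=
  fun x hx => by nlinarith [mul_le_mul_of_nonneg_left (h x hx) hc]

lemma IsMinAt.of_smul (hc : 0 < c) (h : IsMinAt A q (c * a) (c * b)) : IsMinAt A q a b := by
  have := h.smul (c := c⁻¹) (by positivity)
  rwa [← mul_assoc, ← mul_assoc, inv_mul_cancel₀ hc.ne', one_mul, one_mul] at this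

lemma mem_face_iff : q ∈ face A w ↔ q ∈ A ∧ IsMinAt A q w.1 w.2 := by
  rw [mem_face]
  refine and_congr_right fun hq => ⟨fun h x hx => ?_, fun h => le_antisymm ?_ (supp_le hq)⟩
  · have := supp_le (w := w) hx
    rw [← h] at this
    unfold pair at this
    exact_mod_cast this
  · refine le_supp ⟨q, hq⟩ fun x hx => ?_
    have := h x hx
    unfold pair
    exact_mod_cast this

lemma mem_coneFace : q ∈ coneFace A u v ↔ q ∈ A ∧ ∃ s t : ℝ, 0 ≤ s ∧ 0 ≤ t ∧ 0 < s + t ∧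
    IsMinAt A q (s * u.1 + t * v.1) (s * u.2 + t * v.2) := by simp [coneFace]

lemma mem_rim : q ∈ rim A ↔ q ∈ A ∧ ∃ a b : ℝ, (a ≠ 0 ∨ b ≠ 0) ∧ IsMinAt A q a b := by
  simp [rim]

lemma coneFace_comm : coneFace A u v = coneFace A v u := by
  ext q
  simp only [mem_coneFace]
  refine and_congr_right fun _ => ⟨?_, ?_⟩ <;>
  · rintro ⟨s, t, hs, ht, hst, h⟩
    exact ⟨t, s, ht, hs, by linarith, by convert h using 1 <;> ring⟩

lemma face_subset_coneFace_left : face A u ⊆ coneFace A u v := fun q hq => by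
  rw [mem_face_iff] at hq
  exact mem_coneFace.2 ⟨hq.1, 1, 0, by simp, by simp, by simp, by simpa using hq.2⟩

lemma face_subset_coneFace_right : face A v ⊆ coneFace A u v := by
  rw [coneFace_comm]; exact face_subset_coneFace_left

lemma coneFace_union (A : Finset (ℤ × ℤ)) (u v : ℤ × ℤ) :
    coneFace A u (u + v) ∪ coneFace A (u + v) v = coneFace A u v := by
  ext q
  simp only [Finset.mem_union, mem_coneFace, Prod.fst_add, Prod.snd_add, Int.cast_add]
  constructor
  · rintro (⟨hq, s, t, hs, ht, hst, h⟩ | ⟨hq, s, t, hs, ht, hst, h⟩)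
    · exact ⟨hq, s + t, t, by positivity, ht, by linarith, by convert h using 1 <;> ring⟩
    · exact ⟨hq, s, s + t, hs, by positivity, by linarith, by convert h using 1 <;> ring⟩
  · rintro ⟨hq, s, t, hs, ht, hst, h⟩
    rcases le_total s t with hle | hle
    · exact Or.inr ⟨hq, s, t - s, hs, by linarith, by linarith, by convert h using 1 <;> ring⟩
    · exact Or.inl ⟨hq, s - t, t, by linarith, ht, by linarith, by convert h using 1 <;> ring⟩

lemma coneFace_inter (A : Finset (ℤ × ℤ)) (u v : ℤ × ℤ) :
    coneFace A u (u + v) ∩ coneFace A (u + v) v = face A (u + v) := by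
  apply Finset.Subset.antisymm
  · intro q hq
    rw [Finset.mem_inter, mem_coneFace, mem_coneFace] at hq
    obtain ⟨⟨hq, s, t, hs, ht, hst, h⟩, -, s', t', hs', ht', hst', h'⟩ := hq
    refine mem_face_iff.2 ⟨hq, ?_⟩
    rcases hs.eq_or_lt with rfl | hs0
    · exact IsMinAt.of_smul (c := t) (by linarith) (by convert h using 1 <;> ring)
    rcases ht'.eq_or_lt with rfl | ht0
    · exact IsMinAt.of_smul (c := s') (by linarith) (by convert h' using 1 <;> ring)
    · refine IsMinAt.of_smul (c := s * t' + t * t' + s * s') (by positivity) ?_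
      convert (h.smul ht0.le).add (h'.smul hs0.le) using 1 <;>
        simp only [Prod.fst_add, Prod.snd_add, Int.cast_add] <;> ring
  · exact Finset.subset_inter face_subset_coneFace_right face_subset_coneFace_left

lemma card_coneFace_split (A : Finset (ℤ × ℤ)) (u v : ℤ × ℤ) :
    ((coneFace A u v).card : ℤ) + (face A (u + v)).card =
      (coneFace A u (u + v)).card + (coneFace A (u + v) v).card := by
  rw [← coneFace_union, ← coneFace_inter]
  exact_mod_cast Finset.card_union_add_card_inter _ _

end coneFace

/-- How far the sum functional of `u`, `v` is from being minimized at a common minimum of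
`u` and `v`. -/
def gap (A : Finset (ℤ × ℤ)) (u v : ℤ × ℤ) : ℤ := supp A (u + v) - supp A u - supp A v

/-- The lattice length lost by cutting the corner given by `u` and `v`. -/
def cornerLoss (A : Finset (ℤ × ℤ)) (u v : ℤ × ℤ) : ℤ :=
  hi A u v - supp A v + (hi A v u - supp A u) + 1 - (coneFace A u v).card

section cornerLoss

variable {A : Finset (ℤ × ℤ)} {u v : ℤ × ℤ}

lemma gap_nonneg (hA : A.Nonempty) (u v : ℤ × ℤ) : 0 ≤ gap A u v := by
  have := supp_add_le hA u v
  unfold gap; linarith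

lemma cornerLoss_comm (A : Finset (ℤ × ℤ)) (u v : ℤ × ℤ) :
    cornerLoss A u v = cornerLoss A v u := by
  unfold cornerLoss; rw [coneFace_comm]; ring

lemma cornerLoss_split (hA : A.Nonempty) (hc : LatticeConvex A) (h : IsBasisPair u v) :
    cornerLoss A u v = gap A u v + cornerLoss A u (u + v) + cornerLoss A (u + v) v := by
  have h1 := card_coneFace_split A u v
  have h2 := card_face hA hc h.add_right.symm
  have h3 : hi A u (u + v) = 1 * supp A u + hi A u v := hi_eq_of_add hA (by simp)
  have h4 : hi A v (u + v) = 1 * supp A v + hi A v u := hi_eq_of_add hA (by simp [add_comm])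
  have h5 : hi A (u + v) v = 1 * supp A (u + v) - lo A (u + v) u := hi_eq_of_sub hA (by simp)
  unfold cornerLoss gap
  linarith

lemma gap_eq_zero_iff (hA : A.Nonempty) : gap A u v = 0 ↔ ∃ q ∈ A, q ∈ face A u ∧ q ∈ face A v := by
  constructor
  · intro h
    obtain ⟨q, hq, e⟩ := exists_eq_supp hA (u + v)
    rw [pair_add_left] at e
    have h1 := supp_le (w := u) hq
    have h2 := supp_le (w := v) hq
    unfold gap at h
    exact ⟨q, hq, mem_face.2 ⟨hq, by linarith⟩, mem_face.2 ⟨hq, by linarith⟩⟩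
  · rintro ⟨q, hq, h1, h2⟩
    have := supp_le (w := u + v) hq
    rw [pair_add_left, (mem_face.1 h1).2, (mem_face.1 h2).2] at this
    have := supp_add_le hA u v
    unfold gap; linarith

lemma cornerLoss_eq_zero (hA : A.Nonempty) (hc : LatticeConvex A) (h : IsBasisPair u v)
    (h0 : gap A u v = 0) : cornerLoss A u v = 0 := by
  obtain ⟨q, hq, hu, hv⟩ := (gap_eq_zero_iff hA).1 h0
  have hcone : coneFace A u v = face A u ∪ face A v := by
    apply Finset.Subset.antisymm
    · intro x hx
      obtain ⟨hx, s, t, hs, ht, hst, hm⟩ := mem_coneFace.1 hx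
      have h1 := (mem_face_iff.1 hu).2 x hx
      have h2 := (mem_face_iff.1 hv).2 x hx
      have h3 := hm q hq
      rw [Finset.mem_union]
      by_contra! hcon
      have hlt : ∀ w, q ∈ face A w → x ∉ face A w →
          (w.1 * q.1 + w.2 * q.2 : ℝ) < w.1 * x.1 + w.2 * x.2 := fun w hw hxw => by
        by_contra! hle
        exact hxw (mem_face_iff.2 ⟨hx, fun y hy => hle.trans ((mem_face_iff.1 hw).2 y hy)⟩)
      have h4 := hlt u hu hcon.1
      have h5 := hlt v hv hcon.2
      rcases hs.eq_or_lt with rfl | hs0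
      · nlinarith
      · nlinarith [mul_lt_mul_of_pos_left h4 hs0, mul_le_mul_of_nonneg_left h5.le ht]
    · exact Finset.union_subset face_subset_coneFace_left face_subset_coneFace_right
  have hinter : face A u ∩ face A v = {q} := by
    ext x
    rw [Finset.mem_inter, Finset.mem_singleton]
    constructor
    · rintro ⟨h1, h2⟩
      exact h.ext ((mem_face.1 h1).2.trans (mem_face.1 hu).2.symm)
        ((mem_face.1 h2).2.trans (mem_face.1 hv).2.symm)
    · rintro rfl; exact ⟨hu, hv⟩
  have hcard := Finset.card_union_add_card_inter (face A u) (face A v)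
  rw [hinter, ← hcone, Finset.card_singleton] at hcard
  have h1 := card_face hA hc h
  have h2 := card_face hA hc h.symm
  have h3 := supp_le_lo hA u v
  have h4 := supp_le_lo hA v u
  have h5 := lo_le (z := v) hu
  have h6 := lo_le (z := u) hv
  rw [(mem_face.1 hv).2] at h5
  rw [(mem_face.1 hu).2] at h6
  unfold cornerLoss
  zify at hcard
  linarith

/-- The size of the corner given by `u` and `v`. -/
def cornerSize (A : Finset (ℤ × ℤ)) (u v : ℤ × ℤ) : ℤ :=
  lo A u v - supp A v + (lo A v u - supp A u)

lemma cornerSize_nonneg (hA : A.Nonempty) (u v : ℤ × ℤ) : 0 ≤ cornerSize A u v := by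
  have := supp_le_lo hA u v
  have := supp_le_lo hA v u
  unfold cornerSize; linarith

lemma cornerSize_comm (A : Finset (ℤ × ℤ)) (u v : ℤ × ℤ) : cornerSize A u v = cornerSize A v u := by
  unfold cornerSize; ring

lemma cornerSize_add_lt (hA : A.Nonempty) (h : 0 < gap A u v) :
    cornerSize A u (u + v) < cornerSize A u v := by
  have h1 : lo A u (u + v) = 1 * supp A u + lo A u v := lo_eq_of_add hA (by simp)
  have h2 : hi A (u + v) u = 1 * supp A (u + v) - lo A (u + v) v := hi_eq_of_sub hA (by simp)
  have h3 := lo_le_hi hA (u + v) u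
  have h4 := supp_le_lo hA (u + v) v
  obtain ⟨x, hx, e⟩ := exists_eq_lo hA v u
  have h5 := supp_le (w := u + v) (mem_face.1 hx).1
  rw [pair_add_left, (mem_face.1 hx).2] at h5
  unfold gap at h
  unfold cornerSize
  linarith

lemma cornerSize_add_lt' (hA : A.Nonempty) (h : 0 < gap A u v) :
    cornerSize A (u + v) v < cornerSize A u v := by
  rw [cornerSize_comm A (u + v), cornerSize_comm A u, add_comm]
  refine cornerSize_add_lt hA ?_
  unfold gap at *
  rw [add_comm]; linarith

end cornerLoss

/-- `I` is closed under the convexity relations satisfied by the interior lattice points of a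
polygon with lattice points `A`. -/
structure InteriorPair (A I : Finset (ℤ × ℤ)) : Prop where
  nonempty : I.Nonempty
  subset : I ⊆ A
  convex : LatticeConvex A
  convex' : LatticeConvex I
  mix : ∀ i ∈ I, ∀ a ∈ A, ∀ b ∈ A, ∀ (z : ℤ × ℤ) (l m n : ℤ), 0 < l → 0 ≤ m → 0 ≤ n →
    (l + m + n) • z = l • i + m • a + n • b → z ∈ I
  exists_lt : ∀ i ∈ I, ∀ w ≠ 0, ∃ a ∈ A, pair w a < pair w i
  spread : Spread I

/-- The lattice distance between the supporting lines of `A` and of `I` with inner normal `w`. -/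
def depth (A I : Finset (ℤ × ℤ)) (w : ℤ × ℤ) : ℤ := supp I w - supp A w

lemma IsBasisPair.left_ne_zero {u v : ℤ × ℤ} (h : IsBasisPair u v) : u ≠ 0 := by
  rintro rfl; simp [IsBasisPair] at h

namespace InteriorPair

variable {A I : Finset (ℤ × ℤ)} {u v w : ℤ × ℤ}

lemma nonempty' (H : InteriorPair A I) : A.Nonempty := H.nonempty.mono H.subset

lemma one_le_depth (H : InteriorPair A I) (hw : w ≠ 0) : 1 ≤ depth A I w := by
  obtain ⟨i, hi, e⟩ := exists_eq_supp H.nonempty w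
  obtain ⟨a, ha, hlt⟩ := H.exists_lt i hi w hw
  have := supp_le (w := w) ha
  unfold depth; omega

private lemma false_of_supp_le (H : InteriorPair A I) (h : IsBasisPair u v) {C p q : ℤ × ℤ}
    (hC : C ∈ A) (hp : p ∈ I) (hq : q ∈ I)
    (hCuv : pair (u + v) C = supp A (u + v)) (hpu : pair u p = supp I u)
    (hqv : pair v q = supp I v)
    (hlt : depth A I u + depth A I v < depth A I (u + v)) (hu : 1 ≤ depth A I u)
    (hv : 1 ≤ depth A I v) (hcv : supp I v ≤ pair v C) : False := by
  obtain ⟨e, heu, hev⟩ := h.exists_pair_eq 1 0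
  have hz := supp_add_le H.nonempty' u v
  have hqi := supp_le (w := u + v) hq
  have hpi := supp_le (w := u + v) hp
  have hCu := supp_le (w := u) hC
  have hCv := supp_le (w := v) hC
  have hqu := supp_le (w := u) hq
  have hpv := supp_le (w := v) hp
  rw [pair_add_left] at *
  unfold depth at *
  set n := pair v C - supp I v with hn
  set X := pair u p - pair u C with hX
  set y := pair v p - pair v C with hy
  set Q := pair u q - pair u C with hQ
  have hy0 : 0 < y := by omega
  have hQn : n + 1 ≤ Q := by omega
  have hxy : 0 ≤ X + y - 2 := by omega
  have hsum : 0 < n * X + y * Q - n - y := by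
    nlinarith [mul_nonneg (show 0 ≤ n by omega) hxy,
      mul_nonneg hy0.le (show 0 ≤ Q - n - 1 by omega)]
  have hmem : C + e ∈ I := by
    refine H.mix q hq p (H.subset hp) C hC (C + e) y n (n * X + y * Q - n - y) hy0 (by omega)
      hsum.le (h.ext ?_ ?_)
    · simp only [pair_add_right, pair_smul_right, heu]
      linear_combination n * hX + y * hQ
    · simp only [pair_add_right, pair_smul_right, hev]
      linear_combination -y * hqv + n * hy - y * hn
  have := supp_le (w := u + v) hmem
  rw [pair_add_left, pair_add_right, pair_add_right, heu, hev] at this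
  omega

lemma depth_add_le (H : InteriorPair A I) (h : IsBasisPair u v) :
    depth A I (u + v) ≤ depth A I u + depth A I v := by
  by_contra! hlt
  have hu := H.one_le_depth h.left_ne_zero
  have hv := H.one_le_depth h.symm.left_ne_zero
  obtain ⟨C, hC, hCuv⟩ := exists_eq_supp H.nonempty' (u + v)
  obtain ⟨p, hp, hpu⟩ := exists_eq_supp H.nonempty u
  obtain ⟨q, hq, hqv⟩ := exists_eq_supp H.nonempty v
  rcases le_or_gt (supp I v) (pair v C) with h1 | h1
  · exact false_of_supp_le H h hC hp hq hCuv hpu hqv hlt hu hv h1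
  rcases le_or_gt (supp I u) (pair u C) with h2 | h2
  · exact false_of_supp_le H h.symm hC hq hp (by rwa [add_comm]) hqv hpu
      (by rw [add_comm v]; omega) hv hu h2
  obtain ⟨z, hzu, hzv⟩ := h.exists_pair_eq (supp I u) (supp I v)
  have hz := supp_add_le H.nonempty' u v
  have hqi := supp_le (w := u + v) hq
  have hpi := supp_le (w := u + v) hp
  rw [pair_add_left] at *
  unfold depth at *
  set m := supp I u - pair u C with hm
  set n := supp I v - pair v C with hn
  set k := pair v p - supp I v with hk
  set l := pair u q - supp I u with hl
  have hk0 : 0 < k := by omega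
  have hl0 : 0 < l := by omega
  have hm0 : 0 < m := by omega
  have hn0 : 0 < n := by omega
  have hmem : z ∈ I := by
    refine H.mix p hp q (H.subset hq) C hC z (n * l) (m * k) (k * l) (by positivity)
      (by positivity) (by positivity) (h.ext ?_ ?_)
    · simp only [pair_add_right, pair_smul_right, hzu]
      linear_combination -n * l * hpu + m * k * hl + k * l * hm
    · simp only [pair_add_right, pair_smul_right, hzv]
      linear_combination n * l * hk - m * k * hqv + k * l * hn
  have := supp_le (w := u + v) hmem
  rw [pair_add_left] at this
  omega
end InteriorPair

lemma supp_eq_of_forall_le {A : Finset (ℤ × ℤ)} {w p : ℤ × ℤ} (hp : p ∈ A)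
    (h : ∀ x ∈ A, pair w p ≤ pair w x) : supp A w = pair w p :=
  le_antisymm (supp_le hp) (le_supp ⟨p, hp⟩ h)

lemma IsCoprime.exists_mul_eq_one {c : ℤ × ℤ} (h : IsCoprime c.1 c.2) :
    ∃ k d : ℤ × ℤ, pair k c = -1 ∧ pair (-c.2, c.1) d = 1 ∧
      ∀ y : ℤ × ℤ, pair y c = 0 → y = pair y d • (-c.2, c.1) := by
  obtain ⟨a, b, e⟩ := h
  refine ⟨(-a, -b), (-b, a), ?_, ?_, fun y hy => ?_⟩
  · simp only [pair]; linarith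
  · simp only [pair]; linarith
  · simp only [pair] at hy
    ext
    · simp only [pair, Prod.smul_fst, smul_eq_mul]
      linear_combination -y.1 * e + a * hy
    · simp only [pair, Prod.smul_snd, smul_eq_mul]
      linear_combination -y.2 * e + b * hy

namespace InteriorPair

variable {A I : Finset (ℤ × ℤ)} {u v w : ℤ × ℤ}

private lemma ge_of_minimizers (H : InteriorPair A I) {s t p q w : ℤ × ℤ} {α β : ℤ}
    (h : IsBasisPair s t) (hα : 1 ≤ α) (hβ : 1 ≤ β) (hp : p ∈ face I (α • s + β • t))
    (hq : q ∈ face A (α • s + β • t)) (hsq : pair s q = pair s p - 1)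
    (htq : pair t q = pair t p - 1) :
    (w ∈ A → pair s q ≤ pair s w) ∧ (w ∈ I → pair s p ≤ pair s w) := by
  obtain ⟨e, hes, het⟩ := h.exists_pair_eq (-1) 0
  rw [mem_face] at hp hq
  have key : ∀ w ∈ A, pair s w - pair s p ≤ -1 → 0 ≤ pair t w - pair t p →
      (pair s w - pair s p ≤ -2 ∨ w ∈ I) → False := fun w hw hS hT hor => by
    set S := pair s w - pair s p with hSd
    set T := pair t w - pair t p with hTd
    have hmem : p + e ∈ I := by
      rcases hor with hS2 | hwI
      · refine H.mix p hp.1 q hq.1 w hw (p + e) (-S - 1) T 1 (by omega) hT (by omega)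
          (h.ext ?_ ?_)
        · simp only [pair_add_right, pair_smul_right, hes, hsq]; linear_combination hSd
        · simp only [pair_add_right, pair_smul_right, het, htq]; linear_combination hTd
      · refine H.mix w hwI q hq.1 p (H.subset hp.1) (p + e) 1 T (-S - 1) (by omega) hT (by omega)
          (h.ext ?_ ?_)
        · simp only [pair_add_right, pair_smul_right, hes, hsq]; linear_combination hSd
        · simp only [pair_add_right, pair_smul_right, het, htq]; linear_combination hTd
    have := supp_le (w := α • s + β • t) hmem
    rw [← hp.2] at this
    simp only [pair_add_right, pair_add_left, pair_smul_left, hes, het] at this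
    linarith
  constructor <;> intro hw <;> by_contra! hlt
  · have h1 := supp_le (w := α • s + β • t) hw
    rw [← hq.2] at h1
    simp only [pair_add_left, pair_smul_left] at h1
    refine key w hw (by omega) ?_ (Or.inl (by omega))
    by_contra! hneg
    nlinarith
  · have h1 := supp_le (w := α • s + β • t) hw
    rw [← hp.2] at h1
    simp only [pair_add_left, pair_smul_left] at h1
    refine key w (H.subset hw) (by omega) ?_ (Or.inr hw)
    by_contra! hneg
    nlinarith

private lemma isCoprime_sub (H : InteriorPair A I) {x p q : ℤ × ℤ} (hp : p ∈ face I x)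
    (hq : q ∈ face A x) (h2 : 2 ≤ depth A I x) : IsCoprime (q - p).1 (q - p).2 := by
  rw [mem_face] at hp hq
  set c := q - p with hc
  have hxc : pair x c = - depth A I x := by
    rw [hc, pair_sub_right, hp.2, hq.2]; unfold depth; ring
  rw [Int.isCoprime_iff_gcd_eq_one]
  set m := Int.gcd c.1 c.2 with hm
  obtain ⟨a, ha⟩ := Int.gcd_dvd_left c.1 c.2
  obtain ⟨b, hb⟩ := Int.gcd_dvd_right c.1 c.2
  rw [← hm] at ha hb
  have hcm : c = (m : ℤ) • (a, b) := by ext <;> simp [ha.symm, hb.symm]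
  rw [hcm, pair_smul_right] at hxc
  by_contra hne
  have hm2 : 2 ≤ (m : ℤ) := by
    rcases Nat.eq_zero_or_pos m with h0 | h0
    · rw [h0] at hxc; simp at hxc; omega
    · omega
  have hlt : pair x (a, b) < 0 := by
    by_contra! hge
    nlinarith
  have hqc : q = p + (m : ℤ) • (a, b) := by rw [← hcm, hc]; abel
  have hmem : p + (a, b) ∈ I := by
    refine H.mix p hp.1 q hq.1 q hq.1 _ (m - 1) 1 0 (by omega) (by omega) (by omega) ?_
    rw [hqc]
    module
  have := supp_le (w := x) hmem
  rw [pair_add_right] at this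
  omega

lemma exists_decomposition (H : InteriorPair A I) {x : ℤ × ℤ} (hx : IsCoprime x.1 x.2)
    (h2 : 2 ≤ depth A I x) :
    (∃ (s t : ℤ × ℤ) (α β : ℤ), IsBasisPair s t ∧ 1 ≤ α ∧ 1 ≤ β ∧ x = α • s + β • t ∧
      ∀ a b : ℤ, 0 ≤ a → 0 ≤ b → depth A I (a • s + b • t) = a + b) ∧
    ∀ p ∈ face I x, ∀ p' ∈ face I x, p' = p := by
  obtain ⟨q, hq⟩ := face_nonempty H.nonempty' x
  have main : ∀ p ∈ face I x, ∃ (s t : ℤ × ℤ) (α β : ℤ), IsBasisPair s t ∧ 1 ≤ α ∧ 1 ≤ β ∧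
      x = α • s + β • t ∧ pair s q = pair s p - 1 ∧ pair t q = pair t p - 1 := fun p hp => by
    obtain ⟨k, d, hkc, hd, hdecomp⟩ := (H.isCoprime_sub hp hq h2).exists_mul_eq_one
    set c := q - p with hc
    set g := depth A I x with hg
    have hxc : pair x c = - g := by
      rw [hc, pair_sub_right, (mem_face.1 hp).2, (mem_face.1 hq).2, hg]; unfold depth; ring
    have hxe := hdecomp (x - g • k) (by
      rw [pair_sub_left, pair_smul_left, hxc, hkc]; ring)
    set m := pair (x - g • k) d
    set e : ℤ × ℤ := (-c.2, c.1) with he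
    have hec : pair e c = 0 := by simp only [pair, he]; ring
    have hdiv := Int.emod_add_mul_ediv m g
    have hr0 := Int.emod_nonneg m (show g ≠ 0 by omega)
    have hr1 := Int.emod_lt_of_pos m (show 0 < g by omega)
    set j := m / g
    set ρ := m % g
    have hxs : x = g • (k + j • e) + ρ • e := by
      rw [sub_eq_iff_eq_add, ← hdiv] at hxe
      rw [hxe]; module
    have hρ : ρ ≠ 0 := fun h0 => by
      rw [h0, zero_smul, add_zero] at hxs
      have h1 : x.1 = g * (k + j • e).1 := by rw [hxs, Prod.smul_fst, smul_eq_mul]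
      have h2 : x.2 = g * (k + j • e).2 := by rw [hxs, Prod.smul_snd, smul_eq_mul]
      rw [h1, h2] at hx
      have := hx.isUnit_of_dvd' (dvd_mul_right _ _) (dvd_mul_right _ _)
      rw [Int.isUnit_iff] at this
      omega
    refine ⟨k + j • e, k + j • e + e, g - ρ, ρ, ?_, by omega, by omega, ?_, ?_, ?_⟩
    · right
      simp only [pair] at hkc
      simp [he]
      linarith
    · rw [hxs]; module
    · have : pair (k + j • e) c = -1 := by simp [-zsmul_eq_mul, hec, hkc]
      rw [hc, pair_sub_right] at this; omega
    · have : pair (k + j • e + e) c = -1 := by simp [-zsmul_eq_mul, hec, hkc]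
      rw [hc, pair_sub_right] at this; omega
  constructor
  · obtain ⟨p, hp⟩ := face_nonempty H.nonempty x
    obtain ⟨s, t, α, β, h, hα, hβ, rfl, hs, ht⟩ := main p hp
    refine ⟨s, t, α, β, h, hα, hβ, rfl, fun a b ha hb => ?_⟩
    have ms := fun w => H.ge_of_minimizers (w := w) h hα hβ hp hq hs ht
    have mt := fun w => H.ge_of_minimizers (w := w) h.symm hβ hα (by rwa [add_comm])
      (by rwa [add_comm]) ht hs
    have e1 : supp I (a • s + b • t) = pair (a • s + b • t) p :=
      supp_eq_of_forall_le (mem_face.1 hp).1 fun y hy => by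
        simp only [pair_add_left, pair_smul_left]
        exact add_le_add (mul_le_mul_of_nonneg_left ((ms y).2 hy) ha)
          (mul_le_mul_of_nonneg_left ((mt y).2 hy) hb)
    have e2 : supp A (a • s + b • t) = pair (a • s + b • t) q :=
      supp_eq_of_forall_le (mem_face.1 hq).1 fun y hy => by
        simp only [pair_add_left, pair_smul_left]
        exact add_le_add (mul_le_mul_of_nonneg_left ((ms y).1 hy) ha)
          (mul_le_mul_of_nonneg_left ((mt y).1 hy) hb)
    unfold depth
    rw [e1, e2]
    simp only [pair_add_left, pair_smul_left, hs, ht]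
    ring
  · intro p hp p' hp'
    obtain ⟨s, t, α, β, h, hα, hβ, rfl, hs, ht⟩ := main p hp
    have m1 := (H.ge_of_minimizers (w := p') h hα hβ hp hq hs ht).2 (mem_face.1 hp').1
    have m2 := (H.ge_of_minimizers (w := p') h.symm hβ hα (by rwa [add_comm])
      (by rwa [add_comm]) ht hs).2 (mem_face.1 hp').1
    have e := (mem_face.1 hp').2.trans (mem_face.1 hp).2.symm
    simp only [pair_add_left, pair_smul_left] at e
    exact h.ext (by nlinarith) (by nlinarith)

lemma gap_le_gap (H : InteriorPair A I) (h : IsBasisPair u v) : gap I u v ≤ gap A u v := by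
  have := H.depth_add_le h
  unfold depth at this
  unfold gap; linarith

lemma gap_eq_zero (H : InteriorPair A I) (h : IsBasisPair u v) (h0 : gap A u v = 0) :
    gap I u v = 0 :=
  le_antisymm (h0 ▸ H.gap_le_gap h) (gap_nonneg H.nonempty u v)

lemma cornerLoss_le (H : InteriorPair A I) (h : IsBasisPair u v) :
    cornerLoss I u v ≤ cornerLoss A u v := by
  induction hn : (cornerSize A u v).toNat using Nat.strong_induction_on generalizing u v with
  | _ n ih =>
  have hA := H.nonempty'
  rcases (gap_nonneg hA u v).eq_or_lt with h0 | h0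
  · rw [cornerLoss_eq_zero hA H.convex h h0.symm,
      cornerLoss_eq_zero H.nonempty H.convex' h (H.gap_eq_zero h h0.symm)]
  · have l1 := cornerSize_add_lt hA h0
    have l2 := cornerSize_add_lt' hA h0
    have n1 := cornerSize_nonneg hA u (u + v)
    have n2 := cornerSize_nonneg hA (u + v) v
    have := ih _ (by omega) h.add_right rfl
    have := ih _ (by omega) h.add_left rfl
    have := H.gap_le_gap h
    rw [cornerLoss_split hA H.convex h, cornerLoss_split H.nonempty H.convex' h]
    linarith

lemma gap_eq_zero_of_cornerLoss_eq (H : InteriorPair A I) (h : IsBasisPair u v)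
    (he : cornerLoss A u v = cornerLoss I u v) : gap A u v = 0 := by
  induction hn : (cornerSize A u v).toNat using Nat.strong_induction_on generalizing u v with
  | _ n ih =>
  have hA := H.nonempty'
  by_contra hne
  have h0 : 0 < gap A u v := lt_of_le_of_ne (gap_nonneg hA u v) (Ne.symm hne)
  have l1 := cornerSize_add_lt hA h0
  have l2 := cornerSize_add_lt' hA h0
  have n1 := cornerSize_nonneg hA u (u + v)
  have n2 := cornerSize_nonneg hA (u + v) v
  have c1 := H.cornerLoss_le h.add_right
  have c2 := H.cornerLoss_le h.add_left
  have c3 := H.gap_le_gap h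
  rw [cornerLoss_split hA H.convex h, cornerLoss_split H.nonempty H.convex' h] at he
  have g1 := H.gap_eq_zero h.add_right (ih _ (by omega) h.add_right (by linarith) rfl)
  have g2 := H.gap_eq_zero h.add_left (ih _ (by omega) h.add_left (by linarith) rfl)
  have hdepth : 2 ≤ depth A I (u + v) := by
    have := H.one_le_depth h.left_ne_zero
    have := H.one_le_depth h.symm.left_ne_zero
    unfold gap at c3 he
    unfold depth at *
    linarith
  obtain ⟨q, hq, hqu, hquv⟩ := (gap_eq_zero_iff H.nonempty).1 g1
  obtain ⟨q', hq', hquv', hqv⟩ := (gap_eq_zero_iff H.nonempty).1 g2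
  have := (H.exists_decomposition h.add_left.isCoprime hdepth).2 q hquv q' hquv'
  subst this
  have := (gap_eq_zero_iff H.nonempty).2 ⟨q', hq', hqu, hqv⟩
  linarith

end InteriorPair

section rim

variable {A : Finset (ℤ × ℤ)} {q u v v' : ℤ × ℤ} {a b : ℝ}

lemma Spread.eq_zero (hs : Spread A) (h : IsMinAt A q a b) (h' : IsMinAt A q (-a) (-b)) :
    a = 0 ∧ b = 0 :=
  hs a b fun x hx y hy => by linarith [h x hx, h' x hx, h y hy, h' y hy]

lemma IsBasisPair.cast_det_sq (h : IsBasisPair v u) :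
    ((v.1 : ℝ) * u.2 - v.2 * u.1) ^ 2 = 1 := by
  have h' : (v.1 * u.2 - v.2 * u.1) ^ 2 = 1 := by rcases h with h | h <;> rw [h] <;> norm_num
  exact_mod_cast h'

lemma IsBasisPair.eq_zero (h : IsBasisPair v u) (h1 : a * u.1 + b * v.1 = 0)
    (h2 : a * u.2 + b * v.2 = 0) : a = 0 ∧ b = 0 := by
  have hd := h.cast_det_sq
  constructor
  · linear_combination ((v.1 : ℝ) * u.2 - v.2 * u.1) * (v.1 * h2 - v.2 * h1) - a * hd
  · linear_combination ((v.1 : ℝ) * u.2 - v.2 * u.1) * (u.2 * h1 - u.1 * h2) - b * hd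

lemma IsBasisPair.exists_combination (h : IsBasisPair v u) (c d : ℝ) :
    ∃ a b : ℝ, c = a * u.1 + b * v.1 ∧ d = a * u.2 + b * v.2 := by
  have hd := h.cast_det_sq
  refine ⟨((v.1 : ℝ) * u.2 - v.2 * u.1) * (v.1 * d - v.2 * c),
    ((v.1 : ℝ) * u.2 - v.2 * u.1) * (u.2 * c - u.1 * d), ?_, ?_⟩
  · linear_combination -c * hd
  · linear_combination -d * hd

/-- The points minimizing a nonzero functional in the half-plane bounded by `u` and
containing `v`. -/
lemma mem_halfFace : q ∈ coneFace A u v ∪ coneFace A v (-u) ↔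
    q ∈ A ∧ ∃ s t : ℝ, 0 ≤ t ∧ (s ≠ 0 ∨ t ≠ 0) ∧
      IsMinAt A q (s * u.1 + t * v.1) (s * u.2 + t * v.2) := by
  simp only [Finset.mem_union, mem_coneFace, Prod.fst_neg, Prod.snd_neg, Int.cast_neg]
  constructor
  · rintro (⟨hq, s, t, hs, ht, hst, h⟩ | ⟨hq, s, t, hs, ht, hst, h⟩)
    · exact ⟨hq, s, t, ht, by by_contra! h0; linarith, h⟩
    · exact ⟨hq, -t, s, hs, by by_contra! h0; linarith, by convert h using 1 <;> ring⟩
  · rintro ⟨hq, s, t, ht, hst, h⟩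
    rcases le_total 0 s with hs | hs
    · refine Or.inl ⟨hq, s, t, hs, ht, ?_, h⟩
      by_contra! h0
      rcases hst with hst | hst <;> exact hst (by linarith)
    · refine Or.inr ⟨hq, t, -s, ht, by linarith, ?_, by convert h using 1 <;> ring⟩
      by_contra! h0
      rcases hst with hst | hst <;> exact hst (by linarith)

lemma halfFace_inter (hs : Spread A) (h : IsBasisPair v u) :
    coneFace A u v ∩ coneFace A v (-u) = face A v := by
  refine Finset.Subset.antisymm (fun q hq => ?_)
    (Finset.subset_inter face_subset_coneFace_right face_subset_coneFace_left)
  simp only [Finset.mem_inter, mem_coneFace, Prod.fst_neg, Prod.snd_neg, Int.cast_neg] at hq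
  obtain ⟨⟨hq, s, t, hs0, ht, hst, hm⟩, -, t', s', ht', hs', hst', hm'⟩ := hq
  refine mem_face_iff.2 ⟨hq, ?_⟩
  rcases (show 0 ≤ s' * t + s * t' by positivity).eq_or_lt with h0 | h0
  · have e1 : s' * t = 0 := by nlinarith [mul_nonneg hs' ht, mul_nonneg hs0 ht']
    have e2 : s * t' = 0 := by nlinarith [mul_nonneg hs' ht, mul_nonneg hs0 ht']
    rcases hs0.eq_or_lt with rfl | hs0
    · exact IsMinAt.of_smul (c := t) (by linarith) (by convert hm using 1 <;> ring)
    rcases hs'.eq_or_lt with rfl | hs'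
    · exact IsMinAt.of_smul (c := t') (by linarith) (by convert hm' using 1 <;> ring)
    obtain rfl : t = 0 := by nlinarith
    obtain rfl : t' = 0 := by nlinarith
    have := hs.eq_zero (q := q) (a := u.1) (b := u.2)
      (IsMinAt.of_smul hs0 (by convert hm using 1 <;> ring))
      (IsMinAt.of_smul hs' (by convert hm' using 1 <;> ring))
    exact absurd (Prod.ext (by exact_mod_cast this.1) (by exact_mod_cast this.2))
      h.symm.left_ne_zero
  · refine IsMinAt.of_smul h0 ?_
    convert (hm.smul hs').add (hm'.smul hs0) using 1 <;> ring

lemma card_rim (hA : A.Nonempty) (hc : LatticeConvex A) (hs : Spread A) (h : IsBasisPair v u)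
    {b : ℤ} (hv : v + v' = b • u) :
    ((rim A).card : ℤ) = (b - 2) * supp A u - (b + 2) * supp A (-u) - 2 * supp A v
      - 2 * supp A v' - (cornerLoss A u v + cornerLoss A v (-u) + cornerLoss A (-u) v'
        + cornerLoss A v' u) := by
  obtain rfl : v' = b • u - v := by rw [← hv]; abel
  set v' := b • u - v with hv'
  have h' : IsBasisPair v' u := by
    rw [hv']; unfold IsBasisPair at *
    simp only [Prod.fst_sub, Prod.snd_sub, Prod.smul_fst, Prod.smul_snd, smul_eq_mul]
    grind
  have c1 : (v'.1 : ℝ) = b * u.1 - v.1 := by rw [hv']; simp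
  have c2 : (v'.2 : ℝ) = b * u.2 - v.2 := by rw [hv']; simp
  set R := coneFace A u v ∪ coneFace A v (-u)
  set L := coneFace A u v' ∪ coneFace A v' (-u)
  have hrim : rim A = R ∪ L := by
    ext q
    rw [Finset.mem_union, mem_halfFace, mem_halfFace, mem_rim, ← and_or_left]
    refine and_congr_right fun hq => ⟨?_, ?_⟩
    · rintro ⟨c, d, hcd, hm⟩
      obtain ⟨s, t, rfl, rfl⟩ := h.exists_combination c d
      have hst : s ≠ 0 ∨ t ≠ 0 := by by_contra! h0; simp [h0.1, h0.2] at hcd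
      rcases le_total 0 t with ht | ht
      · exact Or.inl ⟨s, t, ht, hst, hm⟩
      · refine Or.inr ⟨s + t * b, -t, by linarith, ?_, ?_⟩
        · by_contra! h0
          have : t = 0 := by linarith
          simp [this] at h0 hst; exact hst h0
        · rw [c1, c2]; convert hm using 1 <;> ring
    · rintro (⟨s, t, ht, hst, hm⟩ | ⟨s, t, ht, hst, hm⟩)
      · refine ⟨_, _, ?_, hm⟩
        by_contra! h0
        have := h.eq_zero h0.1 h0.2
        simp [this.1, this.2] at hst
      · refine ⟨_, _, ?_, hm⟩
        by_contra! h0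
        have := h'.eq_zero h0.1 h0.2
        simp [this.1, this.2] at hst
  have hinter : R ∩ L = face A u ∪ face A (-u) := by
    have huniq : ∀ q ∈ A, ∀ s : ℝ, s ≠ 0 → IsMinAt A q (s * u.1) (s * u.2) →
        q ∈ face A u ∪ face A (-u) := fun q hq s hs0 hm => by
      rw [Finset.mem_union, mem_face_iff, mem_face_iff]
      rcases hs0.lt_or_gt with hlt | hgt
      · refine Or.inr ⟨hq, IsMinAt.of_smul (c := -s) (by linarith) ?_⟩
        convert hm using 1 <;> simp
      · exact Or.inl ⟨hq, IsMinAt.of_smul hgt hm⟩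
    refine Finset.Subset.antisymm (fun q hq => ?_) ?_
    · rw [Finset.mem_inter, mem_halfFace, mem_halfFace] at hq
      obtain ⟨⟨hq, s, t, ht, hst, hm⟩, -, s', t', ht', hst', hm'⟩ := hq
      rcases ht.eq_or_lt with rfl | ht
      · exact huniq q hq s (by simpa using hst) (by convert hm using 1 <;> ring)
      rcases ht'.eq_or_lt with rfl | ht'
      · exact huniq q hq s' (by simpa using hst') (by convert hm' using 1 <;> ring)
      have hsum := (hm.smul ht'.le).add (hm'.smul ht.le)
      rw [c1, c2] at hsum
      by_cases h0 : t' * s + t * s' + t * t' * b = 0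
      · have := hs.eq_zero (q := q) hm (IsMinAt.of_smul (c := t') ht' (by
          convert hm'.smul ht.le using 1
          · rw [c1]; linear_combination -h0 * (u.1 : ℝ)
          · rw [c2]; linear_combination -h0 * (u.2 : ℝ)))
        exact absurd (h.eq_zero this.1 this.2).2 ht.ne'
      · exact huniq q hq _ h0 (by convert hsum using 1 <;> ring)
    · refine Finset.union_subset (Finset.subset_inter ?_ ?_) (Finset.subset_inter ?_ ?_)
      · exact face_subset_coneFace_left.trans Finset.subset_union_left
      · exact face_subset_coneFace_left.trans Finset.subset_union_left
      · exact face_subset_coneFace_right.trans Finset.subset_union_right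
      · exact face_subset_coneFace_right.trans Finset.subset_union_right
  have hdisj : Disjoint (face A u) (face A (-u)) := by
    rw [Finset.disjoint_left]
    intro q hq hq'
    have := hs.eq_zero (mem_face_iff.1 hq).2 (by simpa using (mem_face_iff.1 hq').2)
    exact h.symm.left_ne_zero (Prod.ext (by exact_mod_cast this.1) (by exact_mod_cast this.2))
  have k1 := Finset.card_union_add_card_inter R L
  rw [← hrim, hinter, Finset.card_union_of_disjoint hdisj] at k1
  have k2 := Finset.card_union_add_card_inter (coneFace A u v) (coneFace A v (-u))
  rw [halfFace_inter hs h] at k2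
  have k3 := Finset.card_union_add_card_inter (coneFace A u v') (coneFace A v' (-u))
  rw [halfFace_inter hs h'] at k3
  change R.card + _ = _ at k2
  change L.card + _ = _ at k3
  have f1 := card_face hA hc h.symm
  have f3 := card_face hA hc h
  have f4 := card_face hA hc h'
  have f2 := card_face hA hc h.neg_right.symm
  have e1 : hi A u v' = b * supp A u - lo A u v := hi_eq_of_sub hA hv'
  have e2 : hi A (-u) v' = (-b) * supp A (-u) - lo A (-u) v := hi_eq_of_sub hA (by rw [hv']; simp)
  have e3 : hi A v (-u) = 0 * supp A v - lo A v u := hi_eq_of_sub hA (by simp)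
  have e4 : hi A v' (-u) = 0 * supp A v' - lo A v' u := hi_eq_of_sub hA (by simp)
  rw [cornerLoss_comm A v', cornerLoss_comm A (-u)]
  unfold cornerLoss
  zify at k1 k2 k3
  linarith

end rim

/-- The determinant of two integral vectors. -/
def det (u v : ℤ × ℤ) : ℤ := u.1 * v.2 - u.2 * v.1

lemma det_smul_add_left (a b : ℤ) (s t u : ℤ × ℤ) :
    det (a • s + b • t) u = a * det s u + b * det t u := by
  simp only [det, Prod.fst_add, Prod.snd_add, Prod.smul_fst, Prod.smul_snd, smul_eq_mul]; ring

lemma det_smul_add_right (a b : ℤ) (s t u : ℤ × ℤ) :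
    det u (a • s + b • t) = a * det u s + b * det u t := by
  simp only [det, Prod.fst_add, Prod.snd_add, Prod.smul_fst, Prod.smul_snd, smul_eq_mul]; ring

lemma det_self (u : ℤ × ℤ) : det u u = 0 := by unfold det; ring

lemma det_comm (u v : ℤ × ℤ) : det u v = -det v u := by unfold det; ring

lemma isBasisPair_iff {u v : ℤ × ℤ} : IsBasisPair u v ↔ det u v = 1 ∨ det u v = -1 := Iff.rfl

lemma IsBasisPair.exists_eq_smul_add_smul {s t : ℤ × ℤ} (h : IsBasisPair s t) (x : ℤ × ℤ) :
    ∃ a b : ℤ, x = a • s + b • t := by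
  rcases h with h | h
  · refine ⟨det x t, det s x, ?_⟩
    ext <;> simp only [det, Prod.fst_add, Prod.snd_add, Prod.smul_fst, Prod.smul_snd, smul_eq_mul]
    · linear_combination -x.1 * h
    · linear_combination -x.2 * h
  · refine ⟨-det x t, -det s x, ?_⟩
    ext <;> simp only [det, Prod.fst_add, Prod.snd_add, Prod.smul_fst, Prod.smul_snd, smul_eq_mul]
    · linear_combination x.1 * h
    · linear_combination x.2 * h

lemma IsCoprime.ne_zero_prod {u : ℤ × ℤ} (h : IsCoprime u.1 u.2) : u ≠ 0 := by
  rintro rfl; exact not_isCoprime_zero_zero h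

namespace InteriorPair

variable {A I : Finset (ℤ × ℤ)} {u v v' : ℤ × ℤ}

lemma spread' (H : InteriorPair A I) : Spread A := fun a b h =>
  H.spread a b fun x hx y hy => h x (H.subset hx) y (H.subset hy)

lemma card_rim_sub_card_rim (H : InteriorPair A I) (h : IsBasisPair v u) {b : ℤ}
    (hv : v + v' = b • u) :
    ((rim A).card : ℤ) - (rim I).card = (2 - b) * depth A I u + (2 + b) * depth A I (-u)
      + 2 * depth A I v + 2 * depth A I v'
      - ((cornerLoss A u v - cornerLoss I u v) + (cornerLoss A v (-u) - cornerLoss I v (-u))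
        + (cornerLoss A (-u) v' - cornerLoss I (-u) v')
        + (cornerLoss A v' u - cornerLoss I v' u)) := by
  rw [card_rim H.nonempty' H.convex H.spread' h hv, card_rim H.nonempty H.convex' H.spread h hv]
  unfold depth; ring

lemma exists_det_eq_one (H : InteriorPair A I) (hu : IsCoprime u.1 u.2) (h1 : depth A I u = 1)
    (h2 : depth A I (-u) = 1) : ∃ v, det v u = 1 ∧ depth A I v = 1 := by
  obtain ⟨x, y, e⟩ := hu
  have hd : det (y, -x) u = 1 := by simp only [det]; linarith
  have hb : IsBasisPair (y, -x) u := Or.inl hd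
  rcases (H.one_le_depth hb.left_ne_zero).eq_or_lt with h | h
  · exact ⟨_, hd, h.symm⟩
  obtain ⟨⟨s, t, α, β, hst, hα, hβ, hv, hdep⟩, -⟩ := H.exists_decomposition hb.isCoprime h
  obtain ⟨a, b, rfl⟩ := hst.exists_eq_smul_add_smul u
  rw [hv, det_smul_add_left, det_smul_add_right, det_smul_add_right, det_self, det_self,
    det_comm t s] at hd
  have d1 : 0 ≤ a → 0 ≤ b → a + b = 1 := fun ha hb => by rw [← hdep a b ha hb, h1]
  have d2 : a ≤ 0 → b ≤ 0 → -a + -b = 1 := fun ha hb => by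
    rw [← hdep (-a) (-b) (by omega) (by omega), ← h2]; congr 1; module
  have ds : depth A I s = 1 := by simpa using hdep 1 0 (by simp) (by simp)
  have dt : depth A I t = 1 := by simpa using hdep 0 1 (by simp) (by simp)
  have es : det s (a • s + b • t) = b * det s t := by rw [det_smul_add_right, det_self]; ring
  have et : det t (a • s + b • t) = -(a * det s t) := by
    rw [det_smul_add_right, det_self, det_comm t s]; ring
  set D := det s t
  have hD : D = 1 ∨ D = -1 := hst
  have key : (b * D = 1 ∨ a * D = -1) := by
    have hd' : (α * b - β * a) * D = 1 := by linarith
    rcases lt_trichotomy a 0 with ha | rfl | ha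
    · rcases lt_trichotomy b 0 with hb | rfl | hb
      · have := d2 ha.le hb.le; omega
      · have := d2 ha.le le_rfl
        right; obtain rfl : a = -1 := by omega
        rcases hD with hD | hD <;> rw [hD] at hd' ⊢ <;> simp at hd' ⊢; omega
      · have : 2 ≤ α * b - β * a := by nlinarith
        rcases hD with hD | hD <;> rw [hD] at hd' <;> omega
    · have : b = 1 ∨ b = -1 := by
        rcases le_total 0 b with hb | hb
        · left; simpa using d1 le_rfl hb
        · right; have := d2 le_rfl hb; omega
      left
      rcases this with rfl | rfl <;>
      rcases hD with hD | hD <;> rw [hD] at hd' ⊢ <;> simp at hd' ⊢ <;> omega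
    · rcases lt_trichotomy b 0 with hb | rfl | hb
      · have : α * b - β * a ≤ -2 := by nlinarith
        rcases hD with hD | hD <;> rw [hD] at hd' <;> omega
      · have := d1 ha.le le_rfl
        right; obtain rfl : a = 1 := by omega
        rcases hD with hD | hD <;> rw [hD] at hd' ⊢ <;> simp at hd' ⊢; omega
      · have := d1 ha.le hb.le; omega
  rcases key with hk | hk
  · exact ⟨s, by rw [es, hk], ds⟩
  · exact ⟨t, by rw [et, hk]; rfl, dt⟩

lemma card_rim_le_of_antipodal (H : InteriorPair A I) (hu : IsCoprime u.1 u.2)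
    (h1 : depth A I u = 1) (h2 : depth A I (-u) = 1) :
    (rim A).card ≤ (rim I).card + 8 := by
  obtain ⟨v, hv, hdv⟩ := H.exists_det_eq_one hu h1 h2
  obtain ⟨v', hv', hdv'⟩ := H.exists_det_eq_one (u := -u) hu.neg_neg h2 (by rwa [neg_neg])
  have hvu : IsBasisPair v u := Or.inl hv
  have hv'u : det v' u = -1 := by rw [← hv']; simp only [det, Prod.fst_neg, Prod.snd_neg]; ring
  obtain ⟨a, b, hab⟩ := hvu.exists_eq_smul_add_smul (v + v')
  have ha : a = 0 := by
    have e : det (v + v') u = det v u + det v' u := by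
      simpa using det_smul_add_left 1 1 v v' u
    rw [hab, det_smul_add_left, det_self, hv, hv'u] at e
    linarith
  rw [ha, zero_smul, zero_add] at hab
  have hv'u' : IsBasisPair v' u := Or.inr hv'u
  have := H.card_rim_sub_card_rim hvu hab
  have := H.cornerLoss_le hvu.symm
  have := H.cornerLoss_le hvu.neg_right
  have := H.cornerLoss_le hv'u'.neg_right.symm
  have := H.cornerLoss_le hv'u'
  rw [h1, h2, hdv, hdv'] at *
  zify
  linarith

private lemma depth_neg_eq_one_of_eq_one {s t s' t' : ℤ × ℤ} {α β α' β' x y : ℤ}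
    (hdep : depth A I t = 1)
    (hdep' : ∀ a b : ℤ, 0 ≤ a → 0 ≤ b → depth A I (a • s' + b • t') = a + b)
    (h1 : depth A I (-(α • s + β • t)) = 1) (hβ : 1 ≤ β) (hαβ : β < α) (hα' : 1 ≤ α')
    (hβ' : 1 ≤ β') (hs : -s = α' • s' + β' • t') (ht : t = x • s' + y • t')
    (hD : β' * x - α' * y = 1) : False := by
  have hy : y ≤ 0 := by
    by_contra! hy
    have hx : 0 < x := by by_contra! hx; nlinarith
    rw [ht, hdep' x y hx.le hy.le] at hdep
    omega
  have hu : -(α • s + β • t) = (α * α' - β * x) • s' + (α * β' - β * y) • t' := by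
    rw [neg_eq_iff_eq_neg] at hs
    rw [hs, ht]; module
  have hB : 2 ≤ α * β' - β * y := by nlinarith
  by_cases hA : 0 ≤ α * α' - β * x
  · rw [hu, hdep' _ _ hA (by omega)] at h1
    omega
  · have : 2 ≤ x := by
      by_contra! hx
      nlinarith
    nlinarith

private lemma depth_neg_eq_one (H : InteriorPair A I) {s t : ℤ × ℤ} {α β : ℤ}
    (h : IsBasisPair s t) (hdep : depth A I t = 1) (h1 : depth A I (-(α • s + β • t)) = 1)
    (hβ : 1 ≤ β) (hαβ : β < α) : depth A I (-s) = 1 := by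
  have hns := h.symm.neg_right.symm
  rcases (H.one_le_depth hns.left_ne_zero).eq_or_lt with h' | h'
  · exact h'.symm
  exfalso
  obtain ⟨⟨s', t', α', β', hst, hα, hβ', hv, hdep'⟩, -⟩ := H.exists_decomposition hns.isCoprime h'
  obtain ⟨x, y, ht⟩ := hst.exists_eq_smul_add_smul t
  have hD : (α' * y - β' * x) * det s' t' = det (-s) t := by
    rw [hv, ht, det_smul_add_left, det_smul_add_right, det_smul_add_right, det_self, det_self,
      det_comm t' s']
    ring
  have hor : β' * x - α' * y = 1 ∨ α' * y - β' * x = 1 := by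
    rcases isBasisPair_iff.1 hst with e | e <;> rcases isBasisPair_iff.1 hns with e' | e' <;>
    rw [e, e'] at hD <;> omega
  rcases hor with hor | hor
  · exact depth_neg_eq_one_of_eq_one hdep hdep' h1 hβ hαβ hα hβ' hv ht hor
  · exact depth_neg_eq_one_of_eq_one hdep (fun a b ha hb => by
      rw [add_comm, hdep' b a hb ha, add_comm])
      h1 hβ hαβ hβ' hα (by rw [hv, add_comm]) (by rw [ht, add_comm]) hor

lemma exists_antipodal_or_triple (H : InteriorPair A I) :
    (∃ u : ℤ × ℤ, IsCoprime u.1 u.2 ∧ depth A I u = 1 ∧ depth A I (-u) = 1) ∨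
    ∃ u v : ℤ × ℤ, IsBasisPair u v ∧ depth A I u = 1 ∧ depth A I v = 1 ∧
      depth A I (-(u + v)) = 1 := by
  obtain ⟨u, hu, h1⟩ : ∃ u : ℤ × ℤ, IsCoprime u.1 u.2 ∧ depth A I u = 1 := by
    have hc : IsCoprime (1 : ℤ) 0 := isCoprime_one_left
    rcases (H.one_le_depth (w := (1, 0)) (by simp)).eq_or_lt with h | h
    · exact ⟨(1, 0), hc, h.symm⟩
    · obtain ⟨⟨s, t, α, β, hst, -, -, -, hdep⟩, -⟩ := H.exists_decomposition (x := (1, 0)) hc h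
      exact ⟨s, hst.isCoprime, by simpa using hdep 1 0 (by simp) (by simp)⟩
  have hnu : IsCoprime (-u).1 (-u).2 := hu.neg_neg
  rcases (H.one_le_depth hnu.ne_zero_prod).eq_or_lt with h | h
  · exact Or.inl ⟨u, hu, h1, h.symm⟩
  obtain ⟨⟨s, t, α, β, hst, hα, hβ, hv, hdep⟩, -⟩ := H.exists_decomposition hnu h
  have ds : depth A I s = 1 := by simpa using hdep 1 0 (by simp) (by simp)
  have dt : depth A I t = 1 := by simpa using hdep 0 1 (by simp) (by simp)
  rw [neg_eq_iff_eq_neg] at hv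
  rw [hv] at h1
  rcases lt_trichotomy α β with hlt | rfl | hlt
  · refine Or.inl ⟨t, hst.symm.isCoprime, dt, H.depth_neg_eq_one hst.symm ds ?_ hα hlt⟩
    rwa [add_comm]
  · right
    have hα1 : α = 1 := by
      rw [← smul_add, ← smul_neg] at hv
      rw [hv, Prod.smul_fst, Prod.smul_snd] at hu
      have := hu.isUnit_of_dvd' (Dvd.intro _ rfl) (Dvd.intro _ rfl)
      rw [Int.isUnit_iff] at this
      omega
    rw [hα1, one_smul, one_smul] at h1
    exact ⟨s, t, hst, ds, dt, h1⟩
  · exact Or.inl ⟨s, hst.isCoprime, ds, H.depth_neg_eq_one hst dt h1 hβ hlt⟩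

lemma card_rim_eq_add_nine_iff (H : InteriorPair A I) :
    (rim A).card = (rim I).card + 9 ↔
      ∃ u v : ℤ × ℤ, IsBasisPair u v ∧ depth A I u = 1 ∧ depth A I v = 1 ∧
        depth A I (-(u + v)) = 1 ∧ gap A u v = 0 ∧ gap A (-(u + v)) u = 0 ∧
        gap A v (-(u + v)) = 0 := by
  constructor
  · intro hcard
    rcases H.exists_antipodal_or_triple with ⟨u, hu, h1, h2⟩ | ⟨u, v, h, hu, hv, hw⟩
    · have := H.card_rim_le_of_antipodal hu h1 h2
      omega
    have hwu : IsBasisPair u (-(u + v)) := h.add_right.neg_right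
    have hwv : IsBasisPair v (-(u + v)) := h.add_left.symm.neg_right
    have hsub := H.card_rim_sub_card_rim hwu (v' := v) (b := -1) (by simp [add_comm])
    rw [neg_neg, hu, hv, hw] at hsub
    have hle := H.depth_add_le h
    have c1 := H.cornerLoss_le hwu.symm
    have c2 := H.cornerLoss_le h.add_right
    have c3 := H.cornerLoss_le h.add_left
    have c4 := H.cornerLoss_le hwv
    rw [hcard] at hsub
    push_cast at hsub
    refine ⟨u, v, h, hu, hv, hw, H.gap_eq_zero_of_cornerLoss_eq h ?_,
      H.gap_eq_zero_of_cornerLoss_eq hwu.symm (by linarith),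
      H.gap_eq_zero_of_cornerLoss_eq hwv (by linarith)⟩
    have hgap : gap A u v = gap I u v := by
      have : depth A I (u + v) = 2 := by linarith
      unfold depth at *
      unfold gap; linarith
    rw [cornerLoss_split H.nonempty' H.convex h, cornerLoss_split H.nonempty H.convex' h]
    linarith
  · rintro ⟨u, v, h, hu, hv, hw, g1, g2, g3⟩
    have hwu : IsBasisPair u (-(u + v)) := h.add_right.neg_right
    have hwv : IsBasisPair v (-(u + v)) := h.add_left.symm.neg_right
    have hsub := H.card_rim_sub_card_rim hwu (v' := v) (b := -1) (by simp [add_comm])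
    have hA := H.nonempty'
    have g1' := H.gap_eq_zero h g1
    have s1 := cornerLoss_split hA H.convex h
    have s2 := cornerLoss_split H.nonempty H.convex' h
    rw [cornerLoss_eq_zero hA H.convex h g1, g1] at s1
    rw [cornerLoss_eq_zero H.nonempty H.convex' h g1', g1'] at s2
    have hdep : depth A I (u + v) = 2 := by
      unfold gap at g1 g1'
      unfold depth at *
      linarith
    rw [neg_neg, hu, hv, hw, hdep, cornerLoss_eq_zero hA H.convex hwu.symm g2,
      cornerLoss_eq_zero H.nonempty H.convex' hwu.symm (H.gap_eq_zero hwu.symm g2),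
      cornerLoss_eq_zero hA H.convex hwv g3,
      cornerLoss_eq_zero H.nonempty H.convex' hwv (H.gap_eq_zero hwv g3)] at hsub
    zify
    linarith

end InteriorPair

section planar

variable {K : Set (ℝ × ℝ)} {a b c : ℝ}

lemma lt_of_mem_interior {z : ℝ × ℝ} (hz : z ∈ interior K) (h0 : a ≠ 0 ∨ b ≠ 0)
    (h : ∀ y ∈ K, c ≤ a * y.1 + b * y.2) : c < a * z.1 + b * z.2 := by
  have hcont : Filter.Tendsto (fun t : ℝ => z - t • (a, b)) (nhds 0) (nhds z) := by
    have : Continuous fun t : ℝ => z - t • (a, b) := by fun_prop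
    simpa using this.tendsto 0
  have hev := hcont.eventually (isOpen_interior.mem_nhds hz)
  obtain ⟨t, ht, hpos⟩ := ((hev.filter_mono nhdsWithin_le_nhds).and
    (self_mem_nhdsWithin (a := (0 : ℝ)) (s := Set.Ioi 0))).exists
  have h1 := h _ (interior_subset ht)
  simp only [Prod.fst_sub, Prod.snd_sub, Prod.smul_fst, Prod.smul_snd, smul_eq_mul] at h1
  have h2 : 0 < a * a + b * b := by
    rcases h0 with h0 | h0
    · nlinarith [mul_self_pos.2 h0, mul_self_nonneg b]
    · nlinarith [mul_self_pos.2 h0, mul_self_nonneg a]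
  nlinarith [mul_pos (Set.mem_Ioi.1 hpos) h2]

lemma convex_le (a b c : ℝ) : Convex ℝ {z : ℝ × ℝ | c ≤ a * z.1 + b * z.2} := by
  intro x hx y hy s t hs ht hst
  simp only [Set.mem_ofPred_eq, Prod.fst_add, Prod.snd_add, Prod.smul_fst, Prod.smul_snd,
    smul_eq_mul] at *
  calc c = s * c + t * c := by rw [← add_mul, hst, one_mul]
    _ ≤ s * (a * x.1 + b * x.2) + t * (a * y.1 + b * y.2) :=
      add_le_add (mul_le_mul_of_nonneg_left hx hs) (mul_le_mul_of_nonneg_left hy ht)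
    _ = _ := by ring

lemma interior_convexHull_nonempty {s : Set (ℝ × ℝ)} (hs : ¬ Collinear ℝ s) :
    (interior (convexHull ℝ s)).Nonempty := by
  have hne : s.Nonempty := by
    by_contra! h
    exact hs (h ▸ collinear_empty ℝ _)
  rw [(convex_convexHull ℝ s).interior_nonempty_iff_affineSpan_eq_top, affineSpan_convexHull,
    AffineSubspace.affineSpan_eq_top_iff_vectorSpan_eq_top_of_nonempty ℝ _ _ hne]
  rw [collinear_iff_finrank_le_one, not_le] at hs
  apply Submodule.eq_top_of_finrank_eq
  have h1 := Submodule.finrank_le (vectorSpan ℝ s)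
  have h2 : Module.finrank ℝ (ℝ × ℝ) = 2 := by simp
  omega

lemma collinear_of_forall_eq {s : Set (ℝ × ℝ)} (h0 : a ≠ 0 ∨ b ≠ 0)
    (h : ∀ x ∈ s, ∀ y ∈ s, a * x.1 + b * x.2 = a * y.1 + b * y.2) : Collinear ℝ s := by
  rcases s.eq_empty_or_nonempty with rfl | ⟨p, hp⟩
  · exact collinear_empty ℝ _
  rw [collinear_iff_of_mem hp]
  have h2 : a * a + b * b ≠ 0 := by
    rcases h0 with h0 | h0
    · nlinarith [mul_self_pos.2 h0, mul_self_nonneg b]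
    · nlinarith [mul_self_pos.2 h0, mul_self_nonneg a]
  refine ⟨(-b, a), fun x hx => ⟨(a * (x.2 - p.2) - b * (x.1 - p.1)) / (a * a + b * b), ?_⟩⟩
  have e := h x hx p hp
  ext
  · simp only [vadd_eq_add, Prod.fst_add, Prod.smul_fst, smul_eq_mul]
    rw [← sub_eq_iff_eq_add, div_mul_eq_mul_div, eq_div_iff h2]
    linear_combination a * e
  · simp only [vadd_eq_add, Prod.snd_add, Prod.smul_snd, smul_eq_mul]
    rw [← sub_eq_iff_eq_add, div_mul_eq_mul_div, eq_div_iff h2]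
    linear_combination b * e

end planar

section lattice

variable {A I : Finset (ℤ × ℤ)}

lemma finite_latticePts {K : Set (ℝ × ℝ)} (hK : Bornology.IsBounded K) :
    (latticePts K).Finite := by
  obtain ⟨R, hR⟩ := hK.subset_closedBall 0
  refine (Set.finite_Icc (-⌈R⌉, -⌈R⌉) (⌈R⌉, ⌈R⌉)).subset fun p hp => ?_
  have h := hR hp
  rw [mem_closedBall_zero_iff, Prod.norm_def, sup_le_iff, Real.norm_eq_abs, Real.norm_eq_abs,
    abs_le, abs_le] at h
  simp only [toR2] at h
  have hc := Int.le_ceil R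
  have k1 : (p.1 : ℝ) ≤ ⌈R⌉ := by linarith
  have k2 : (p.2 : ℝ) ≤ ⌈R⌉ := by linarith
  have k3 : -(⌈R⌉ : ℝ) ≤ p.1 := by linarith
  have k4 : -(⌈R⌉ : ℝ) ≤ p.2 := by linarith
  exact ⟨⟨by exact_mod_cast k3, by exact_mod_cast k4⟩,
    ⟨by exact_mod_cast k1, by exact_mod_cast k2⟩⟩

lemma bdPts_convexHull (hA : latticePts (convexHull ℝ (toR2 '' (A : Set (ℤ × ℤ)))) = A)
    (hne : (interior (convexHull ℝ (toR2 '' (A : Set (ℤ × ℤ))))).Nonempty) :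
    bdPts (convexHull ℝ (toR2 '' (A : Set (ℤ × ℤ)))) = rim A := by
  set K := convexHull ℝ (toR2 '' (A : Set (ℤ × ℤ))) with hK
  have hconv : Convex ℝ K := convex_convexHull ℝ _
  have hclosed : IsClosed K := (A.finite_toSet.image toR2).isClosed_convexHull ℝ
  have hAK : ∀ x, x ∈ A ↔ toR2 x ∈ K := fun x => by
    rw [← Finset.mem_coe, ← hA]; rfl
  ext q
  rw [Finset.mem_coe, mem_rim, hAK]
  change toR2 q ∈ frontier K ↔ _
  rw [hclosed.frontier_eq]
  refine and_congr_right fun hq => ⟨fun hint => ?_, ?_⟩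
  · obtain ⟨f, hf⟩ := geometric_hahn_banach_open_point hconv.interior isOpen_interior hint
    have hfz : ∀ z : ℝ × ℝ, f z = f (1, 0) * z.1 + f (0, 1) * z.2 := fun z => by
      have : z = z.1 • ((1 : ℝ), (0 : ℝ)) + z.2 • ((0 : ℝ), (1 : ℝ)) := by ext <;> simp
      conv_lhs => rw [this, map_add, map_smul, map_smul, smul_eq_mul, smul_eq_mul]
      ring
    refine ⟨-f (1, 0), -f (0, 1), ?_, fun x hx => ?_⟩
    · by_contra! h0
      obtain ⟨z, hz⟩ := hne
      have := hf z hz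
      rw [hfz z, hfz (toR2 q), neg_eq_zero.1 h0.1, neg_eq_zero.1 h0.2] at this
      simp at this
    · have hle : f (toR2 x) ≤ f (toR2 q) := by
        have hsub : K ⊆ closure (interior K) := by
          rw [hconv.closure_interior_eq_closure_of_nonempty_interior hne]
          exact subset_closure
        exact closure_minimal (fun z hz => (hf z hz).le)
          (isClosed_le f.continuous continuous_const) (hsub ((hAK x).1 hx))
      rw [hfz (toR2 x), hfz (toR2 q)] at hle
      simp only [toR2] at hle
      linarith
  · rintro ⟨a, b, h0, hm⟩ hint
    have hle : K ⊆ {z : ℝ × ℝ | a * q.1 + b * q.2 ≤ a * z.1 + b * z.2} := by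
      refine convexHull_min ?_ (convex_le _ _ _)
      rintro _ ⟨x, hx, rfl⟩
      exact hm x hx
    exact (lt_of_mem_interior hint h0 hle).ne rfl

lemma smul_toR2 {z x y w : ℤ × ℤ} {l m n : ℤ} (h : (l + m + n) • z = l • x + m • y + n • w) :
    ((l : ℝ) + m + n) • toR2 z = (l : ℝ) • toR2 x + (m : ℝ) • toR2 y + (n : ℝ) • toR2 w := by
  have h1 := congrArg (fun p : ℤ × ℤ => (p.1 : ℝ)) h
  have h2 := congrArg (fun p : ℤ × ℤ => (p.2 : ℝ)) h
  simp only [Prod.fst_add, Prod.snd_add, Prod.smul_fst, Prod.smul_snd, smul_eq_mul] at h1 h2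
  push_cast at h1 h2
  ext
  · simpa [toR2] using h1
  · simpa [toR2] using h2

lemma latticeConvex_of_convex {K : Set (ℝ × ℝ)} (hK : Convex ℝ K)
    (hA : ∀ x, x ∈ A ↔ toR2 x ∈ K) : LatticeConvex A := by
  intro x hx y hy z m n hm hn hmn h
  rw [hA] at *
  have h' := smul_toR2 (l := m) (m := n) (n := 0) (w := 0) (x := x) (y := y) (z := z)
    (by simpa using h)
  have hpos : (0 : ℝ) < m + n := by exact_mod_cast hmn
  simp only [Int.cast_zero, add_zero, zero_smul] at h'
  have e : toR2 z = ((m : ℝ) / (m + n)) • toR2 x + ((n : ℝ) / (m + n)) • toR2 y := by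
    rw [div_eq_inv_mul, div_eq_inv_mul, mul_smul, mul_smul, ← smul_add, ← h', smul_smul,
      inv_mul_cancel₀ hpos.ne', one_smul]
  rw [e]
  exact hK hx hy (div_nonneg (by exact_mod_cast hm) hpos.le)
    (div_nonneg (by exact_mod_cast hn) hpos.le) (by field_simp)

lemma interiorPair_of_convex {K : Set (ℝ × ℝ)} (hK : Convex ℝ K)
    (hA : ∀ x, x ∈ A ↔ toR2 x ∈ K) (hI : ∀ x, x ∈ I ↔ toR2 x ∈ interior K)
    (hAK : K = convexHull ℝ (toR2 '' (A : Set (ℤ × ℤ))))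
    (hnc : ¬ Collinear ℝ (toR2 '' (I : Set (ℤ × ℤ)))) : InteriorPair A I where
  nonempty := by
    by_contra h
    rw [Finset.not_nonempty_iff_eq_empty] at h
    simp [h, collinear_empty] at hnc
  subset x hx := (hA x).2 (interior_subset ((hI x).1 hx))
  convex := latticeConvex_of_convex hK hA
  convex' := latticeConvex_of_convex hK.interior hI
  mix i hi x hx y hy z l m n hl hm hn h := by
    rw [hI] at *
    rw [hA] at hx hy
    have h' := smul_toR2 h
    have hl' : (0 : ℝ) < l := by exact_mod_cast hl
    have hm' : (0 : ℝ) ≤ m := by exact_mod_cast hm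
    have hn' : (0 : ℝ) ≤ n := by exact_mod_cast hn
    have hlm : (0 : ℝ) < l + m := by linarith
    have hlmn : (0 : ℝ) < l + m + n := by linarith
    have h1 := hK.combo_interior_self_mem_interior hi hx (a := (l : ℝ) / (l + m))
      (b := (m : ℝ) / (l + m)) (by positivity) (by positivity) (by field_simp)
    have h2 := hK.combo_interior_self_mem_interior h1 hy (a := ((l : ℝ) + m) / (l + m + n))
      (b := (n : ℝ) / (l + m + n)) (by positivity) (by positivity) (by field_simp)
    convert h2 using 1
    rw [smul_add, smul_smul, smul_smul, ← smul_right_injective _ hlmn.ne' |>.eq_iff, h',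
      smul_add, smul_add, smul_smul, smul_smul, smul_smul]
    congr 2 <;> [congr 1; skip; skip] <;> congr 1 <;> field_simp
  exists_lt i hi w hw := by
    by_contra! hge
    refine (lt_of_mem_interior (K := K) (a := w.1) (b := w.2) (c := pair w i)
      ((hI i).1 hi) ?_ ?_).ne (by simp [pair, toR2])
    · by_contra! h0
      exact hw (Prod.ext (by exact_mod_cast h0.1) (by exact_mod_cast h0.2))
    · rw [hAK]
      refine fun y hy => convexHull_min ?_ (convex_le w.1 w.2 (pair w i)) hy
      rintro _ ⟨x, hx, rfl⟩
      have := hge x hx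
      simp only [pair, toR2, Set.mem_ofPred_eq] at *
      exact_mod_cast this
  spread a b h := by
    by_contra! h0
    refine hnc (collinear_of_forall_eq (a := a) (b := b) ?_ ?_)
    · by_cases ha : a = 0
      · exact Or.inr (h0 ha)
      · exact Or.inl ha
    · rintro _ ⟨x, hx, rfl⟩ _ ⟨y, hy, rfl⟩
      exact h x hx y hy

end lattice

lemma mem_stdSimplexD {d : ℕ} (hd : 0 < d) {z : ℝ × ℝ} :
    z ∈ stdSimplexD d ↔ 0 ≤ z.1 ∧ 0 ≤ z.2 ∧ z.1 + z.2 ≤ d := by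
  have hd' : (0 : ℝ) < d := by exact_mod_cast hd
  constructor
  · intro hz
    have key : ∀ a b c : ℝ, c ≤ 0 → c ≤ a * d → c ≤ b * d → c ≤ a * z.1 + b * z.2 := by
      intro a b c h0 h1 h2
      refine convexHull_min ?_ (convex_le a b c) hz
      rintro _ (rfl | rfl | rfl) <;> simpa
    have h1 := key 1 0 0 le_rfl (by simp) (by simp)
    have h2 := key 0 1 0 le_rfl (by simp) (by simp)
    have h3 := key (-1) (-1) (-d) (by simp) (by simp) (by simp)
    exact ⟨by linarith, by linarith, by linarith⟩
  · rintro ⟨h1, h2, h3⟩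
    have := (convex_convexHull ℝ ({((0 : ℝ), (0 : ℝ)), ((d : ℝ), 0), (0, (d : ℝ))} :
      Set (ℝ × ℝ))).sum_mem (t := Finset.univ) (w := ![1 - (z.1 + z.2) / d, z.1 / d, z.2 / d])
      (z := ![((0 : ℝ), (0 : ℝ)), ((d : ℝ), 0), (0, (d : ℝ))])
      (fun i _ => by
        fin_cases i
        · simpa using (div_le_one hd').2 h3
        · exact div_nonneg h1 hd'.le
        · exact div_nonneg h2 hd'.le)
      (by simp only [Fin.sum_univ_three, Matrix.cons_val]; ring)
      (fun i _ => subset_convexHull ℝ _ (by fin_cases i <;> simp))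
    convert this using 1
    · rfl
    · ext <;> simp [Fin.sum_univ_three, hd'.ne']

lemma stdSimplexD_subset {d : ℕ} {s : Set (ℝ × ℝ)} (hs : Convex ℝ s) (h0 : ((0 : ℝ), (0 : ℝ)) ∈ s)
    (h1 : ((d : ℝ), (0 : ℝ)) ∈ s) (h2 : ((0 : ℝ), (d : ℝ)) ∈ s) : stdSimplexD d ⊆ s := by
  refine convexHull_min ?_ hs
  rintro _ (rfl | rfl | rfl) <;> assumption

/-- The affine map with linear part given by `u`, `v` and translation part `(e, f)`. -/
def affineMap (u v : ℤ × ℤ) (e f : ℤ) (q : ℝ × ℝ) : ℝ × ℝ :=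
  ((u.1 : ℝ) * q.1 + (u.2 : ℝ) * q.2 + (e : ℝ), (v.1 : ℝ) * q.1 + (v.2 : ℝ) * q.2 + (f : ℝ))

lemma affineMap_toR2 (u v : ℤ × ℤ) (e f : ℤ) (p : ℤ × ℤ) :
    affineMap u v e f (toR2 p) = (((pair u p + e : ℤ) : ℝ), ((pair v p + f : ℤ) : ℝ)) := by
  simp [affineMap, toR2, pair]

lemma Convex.affineMap_image {K : Set (ℝ × ℝ)} (hK : Convex ℝ K) (u v : ℤ × ℤ) (e f : ℤ) :
    Convex ℝ (affineMap u v e f '' K) := by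
  rintro _ ⟨x, hx, rfl⟩ _ ⟨y, hy, rfl⟩ a b ha hb hab
  refine ⟨a • x + b • y, hK hx hy ha hb hab, ?_⟩
  ext <;> simp only [affineMap, Prod.fst_add, Prod.snd_add, Prod.smul_fst, Prod.smul_snd,
    smul_eq_mul]
  · linear_combination -(e : ℝ) * hab
  · linear_combination -(f : ℝ) * hab

lemma IsBasisPair.affineMap_injective {u v : ℤ × ℤ} (h : IsBasisPair u v) (e f : ℤ) :
    Function.Injective (affineMap u v e f) := by
  intro x y hxy
  simp only [affineMap, Prod.mk.injEq, add_left_inj] at hxy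
  have hd : ((u.1 : ℝ) * v.2 - u.2 * v.1) ≠ 0 := fun h0 => by
    have := h.cast_det_sq
    rw [h0] at this
    norm_num at this
  ext
  · refine mul_left_cancel₀ hd ?_
    linear_combination (v.2 : ℝ) * hxy.1 - (u.2 : ℝ) * hxy.2
  · refine mul_left_cancel₀ hd ?_
    linear_combination (u.1 : ℝ) * hxy.2 - (v.1 : ℝ) * hxy.1

lemma exists_mem_of_gap_eq_zero {A : Finset (ℤ × ℤ)} {u v : ℤ × ℤ}
    (hA : A.Nonempty) (h : gap A u v = 0) : ∃ q ∈ A, pair u q = supp A u ∧ pair v q = supp A v := by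
  obtain ⟨q, hq, h1, h2⟩ := (gap_eq_zero_iff hA).1 h
  exact ⟨q, hq, (mem_face.1 h1).2, (mem_face.1 h2).2⟩

section

variable {A I : Finset (ℤ × ℤ)} {K : Set (ℝ × ℝ)} {u v : ℤ × ℤ}

lemma exists_polytopeEquiv_stdSimplexD (H : InteriorPair A I)
    (hK : K = convexHull ℝ (toR2 '' (A : Set (ℤ × ℤ)))) (h : IsBasisPair u v)
    (hu : depth A I u = 1) (hv : depth A I v = 1) (hw : depth A I (-(u + v)) = 1)
    (g1 : gap A u v = 0) (g2 : gap A (-(u + v)) u = 0) (g3 : gap A v (-(u + v)) = 0) :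
    ∃ d : ℕ, 4 ≤ d ∧ PolytopeEquiv K (stdSimplexD d) := by
  have hd4 : 4 ≤ -supp A u - supp A v - supp A (-(u + v)) := by
    by_contra! hlt
    have hconst : ∀ x ∈ I, pair u x = supp I u := fun x hx => by
      have h1 := supp_le (w := u) hx
      have h2 := supp_le (w := v) hx
      have h3 := supp_le (w := -(u + v)) hx
      rw [pair_neg_left, pair_add_left] at h3
      unfold depth at hu hv hw
      omega
    have := H.spread u.1 u.2 fun x hx y hy => by
      have := (hconst x hx).trans (hconst y hy).symm
      unfold pair at this
      exact_mod_cast this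
    exact h.left_ne_zero (Prod.ext (by exact_mod_cast this.1) (by exact_mod_cast this.2))
  obtain ⟨d, hd⟩ := Int.eq_ofNat_of_zero_le (show 0 ≤ -supp A u - supp A v - supp A (-(u + v)) by
    omega)
  refine ⟨d, by omega, u.1, u.2, v.1, v.2, -supp A u, -supp A v, h, ?_⟩
  change affineMap u v (-supp A u) (-supp A v) '' K = _
  have hAK : ∀ x ∈ A, toR2 x ∈ K := fun x hx => by
    rw [hK]; exact subset_convexHull ℝ _ ⟨x, hx, rfl⟩
  have hconv : Convex ℝ K := hK ▸ convex_convexHull ℝ _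
  apply Set.Subset.antisymm
  · have key : ∀ w : ℤ × ℤ, ∀ y ∈ K, (supp A w : ℝ) ≤ w.1 * y.1 + w.2 * y.2 := fun w y hy => by
      rw [hK] at hy
      refine convexHull_min ?_ (convex_le _ _ _) hy
      rintro _ ⟨x, hx, rfl⟩
      have := supp_le (w := w) hx
      unfold pair at this
      simp only [Set.mem_ofPred_eq, toR2]
      exact_mod_cast this
    rintro _ ⟨y, hy, rfl⟩
    rw [mem_stdSimplexD (by omega)]
    have h1 := key u y hy
    have h2 := key v y hy
    have h3 := key (-(u + v)) y hy
    have hd' : -(supp A u : ℝ) - supp A v - supp A (-(u + v)) = d := by exact_mod_cast hd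
    simp only [Prod.fst_neg, Prod.snd_neg, Prod.fst_add, Prod.snd_add] at h3
    push_cast at h3
    simp only [affineMap]
    push_cast
    exact ⟨by linarith, by linarith, by linarith⟩
  · obtain ⟨q1, hq1, a1, b1⟩ := exists_mem_of_gap_eq_zero H.nonempty' g1
    obtain ⟨q2, hq2, a2, b2⟩ := exists_mem_of_gap_eq_zero H.nonempty' g2
    obtain ⟨q3, hq3, a3, b3⟩ := exists_mem_of_gap_eq_zero H.nonempty' g3
    rw [pair_neg_left, pair_add_left] at a2 b3
    refine stdSimplexD_subset (hconv.affineMap_image _ _ _ _) ⟨_, hAK _ hq1, ?_⟩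
      ⟨_, hAK _ hq3, ?_⟩ ⟨_, hAK _ hq2, ?_⟩ <;> rw [affineMap_toR2] <;> ext
    · simp [a1]
    · simp [b1]
    · rw [show pair u q3 + -supp A u = d by omega]; rfl
    · simp [a3]
    · simp [b2]
    · rw [show pair v q2 + -supp A v = d by omega]; rfl

lemma exists_triple_of_polytopeEquiv {d : ℕ} (hd : 4 ≤ d) (hA : ∀ x, x ∈ A ↔ toR2 x ∈ K)
    (hI : ∀ x, x ∈ I ↔ toR2 x ∈ interior K) (he : PolytopeEquiv K (stdSimplexD d)) :
    ∃ u v : ℤ × ℤ, IsBasisPair u v ∧ depth A I u = 1 ∧ depth A I v = 1 ∧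
      depth A I (-(u + v)) = 1 ∧ gap A u v = 0 ∧ gap A (-(u + v)) u = 0 ∧
      gap A v (-(u + v)) = 0 := by
  obtain ⟨a, b, c, d', e, f, hdet, himg⟩ := he
  set u : ℤ × ℤ := (a, b) with hu
  set v : ℤ × ℤ := (c, d') with hv
  have h : IsBasisPair u v := hdet
  change affineMap u v e f '' K = _ at himg
  have hK : ∀ z, z ∈ K ↔ 0 ≤ (affineMap u v e f z).1 ∧ 0 ≤ (affineMap u v e f z).2 ∧
      (affineMap u v e f z).1 + (affineMap u v e f z).2 ≤ d := fun z => by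
    rw [← mem_stdSimplexD (by omega), ← himg, (h.affineMap_injective e f).mem_set_image]
  have hmemA : ∀ x, x ∈ A ↔ 0 ≤ pair u x + e ∧ 0 ≤ pair v x + f ∧
      pair u x + e + (pair v x + f) ≤ d := fun x => by
    rw [hA, hK, affineMap_toR2]
    dsimp only
    norm_cast
  have hmemI : ∀ x, x ∈ I ↔ 0 < pair u x + e ∧ 0 < pair v x + f ∧
      pair u x + e + (pair v x + f) < d := fun x => by
    have hK' : toR2 x ∈ interior K ↔ 0 < (affineMap u v e f (toR2 x)).1 ∧
        0 < (affineMap u v e f (toR2 x)).2 ∧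
        (affineMap u v e f (toR2 x)).1 + (affineMap u v e f (toR2 x)).2 < d := by
      constructor
      · intro hx
        have hne : ∀ w : ℤ × ℤ, w ≠ 0 → (w.1 : ℝ) ≠ 0 ∨ (w.2 : ℝ) ≠ 0 := fun w hw => by
          by_contra! h0
          exact hw (Prod.ext (by exact_mod_cast h0.1) (by exact_mod_cast h0.2))
        have h1 := lt_of_mem_interior (c := -e) hx (hne u h.left_ne_zero)
          fun y hy => by have := ((hK y).1 hy).1; unfold affineMap at this; linarith
        have h2 := lt_of_mem_interior (c := -f) hx (hne v h.symm.left_ne_zero)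
          fun y hy => by have := ((hK y).1 hy).2.1; unfold affineMap at this; linarith
        have h3 := lt_of_mem_interior (c := e + f - d) hx
          (hne (-(u + v)) h.add_right.neg_right.symm.left_ne_zero)
          fun y hy => by
            have := ((hK y).1 hy).2.2
            unfold affineMap at this
            simp only [Prod.fst_neg, Prod.snd_neg, Prod.fst_add, Prod.snd_add]
            push_cast
            linarith
        simp only [Prod.fst_neg, Prod.snd_neg, Prod.fst_add, Prod.snd_add] at h3
        push_cast at h3
        unfold affineMap
        exact ⟨by linarith, by linarith, by linarith⟩
      · intro hx
        have hc : Continuous (affineMap u v e f) := by unfold affineMap; fun_prop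
        refine interior_maximal (t := {z | 0 < (affineMap u v e f z).1 ∧
          0 < (affineMap u v e f z).2 ∧
          (affineMap u v e f z).1 + (affineMap u v e f z).2 < d})
          (fun z hz => (hK z).2 ⟨hz.1.le, hz.2.1.le, hz.2.2.le⟩) ?_ hx
        exact (isOpen_lt continuous_const hc.fst).inter ((isOpen_lt continuous_const hc.snd).inter
          (isOpen_lt (hc.fst.add hc.snd) continuous_const))
    rw [hI, hK', affineMap_toR2]
    dsimp only
    norm_cast
  have hpt : ∀ i j : ℤ, ∃ x, pair u x = i - e ∧ pair v x = j - f := fun i j =>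
    h.exists_pair_eq _ _
  obtain ⟨x0, xu0, xv0⟩ := hpt 0 0
  obtain ⟨x1, xu1, xv1⟩ := hpt d 0
  obtain ⟨x2, xu2, xv2⟩ := hpt 0 d
  obtain ⟨y0, yu0, yv0⟩ := hpt 1 1
  obtain ⟨y1, yu1, yv1⟩ := hpt (d - 2) 1
  have ax0 : x0 ∈ A := (hmemA _).2 (by omega)
  have ax1 : x1 ∈ A := (hmemA _).2 (by omega)
  have ax2 : x2 ∈ A := (hmemA _).2 (by omega)
  have iy0 : y0 ∈ I := (hmemI _).2 (by omega)
  have iy1 : y1 ∈ I := (hmemI _).2 (by omega)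
  have su : supp A u = pair u x0 := supp_eq_of_forall_le ax0 fun x hx => by
    have := (hmemA x).1 hx; omega
  have sv : supp A v = pair v x0 := supp_eq_of_forall_le ax0 fun x hx => by
    have := (hmemA x).1 hx; omega
  have sw : supp A (-(u + v)) = pair (-(u + v)) x1 := supp_eq_of_forall_le ax1 fun x hx => by
    have := (hmemA x).1 hx
    simp only [pair_neg_left, pair_add_left]; omega
  have tu : supp I u = pair u y0 := supp_eq_of_forall_le iy0 fun x hx => by
    have := (hmemI x).1 hx; omega
  have tv : supp I v = pair v y0 := supp_eq_of_forall_le iy0 fun x hx => by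
    have := (hmemI x).1 hx; omega
  have tw : supp I (-(u + v)) = pair (-(u + v)) y1 := supp_eq_of_forall_le iy1 fun x hx => by
    have := (hmemI x).1 hx
    simp only [pair_neg_left, pair_add_left]; omega
  have hAne : A.Nonempty := ⟨x0, ax0⟩
  have w1 : pair (-(u + v)) x1 = e + f - d := by
    simp only [pair_neg_left, pair_add_left]; omega
  have w2 : pair (-(u + v)) x2 = e + f - d := by
    simp only [pair_neg_left, pair_add_left]; omega
  have w3 : pair (-(u + v)) y1 = e + f - d + 1 := by
    simp only [pair_neg_left, pair_add_left]; omega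
  refine ⟨u, v, h, ?_, ?_, ?_, (gap_eq_zero_iff hAne).2 ⟨x0, ax0, ?_, ?_⟩,
    (gap_eq_zero_iff hAne).2 ⟨x2, ax2, ?_, ?_⟩, (gap_eq_zero_iff hAne).2 ⟨x1, ax1, ?_, ?_⟩⟩
  any_goals rw [mem_face]
  any_goals unfold depth
  · omega
  · omega
  · omega
  · exact ⟨ax0, su.symm⟩
  · exact ⟨ax0, sv.symm⟩
  · exact ⟨ax2, by omega⟩
  · exact ⟨ax2, by omega⟩
  · exact ⟨ax1, by omega⟩
  · exact ⟨ax1, by omega⟩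

end

/-- for a 2-dimensional maximal nonhyperelliptic lattice polytope
`Δ ⊂ ℝ²` one has `r − r⁽¹⁾ = 9` if and only if `Δ` is equivalent to `dΣ` for some
integer `d ≥ 4`. -/
theorem boundary_difference_eq_nine_iff (Δ : Set (ℝ × ℝ))
    (hlat : IsLatticePolytope Δ) (hdim : ¬ Collinear ℝ Δ)
    (hmax : IsMaximalPolytope Δ) (hnh : ¬ IsHyperelliptic Δ) :
    (bdPts Δ).ncard = (bdPts (interiorHull Δ)).ncard + 9 ↔
      ∃ d : ℕ, 4 ≤ d ∧ PolytopeEquiv Δ (stdSimplexD d) := by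
  obtain ⟨S, hS⟩ := hlat
  have hconv : Convex ℝ Δ := hS ▸ convex_convexHull ℝ _
  have hbdd : Bornology.IsBounded Δ :=
    hS ▸ ((S.finite_toSet.image toR2).isCompact_convexHull ℝ).isBounded
  have hAfin := finite_latticePts hbdd
  have hIfin : (intPts Δ).Finite := hAfin.subset fun x hx =>
    interior_subset (s := Δ) hx
  set A := hAfin.toFinset with hAdef
  set I := hIfin.toFinset with hIdef
  have hA : ∀ x, x ∈ A ↔ toR2 x ∈ Δ := fun x => by rw [hAdef, Set.Finite.mem_toFinset]; rfl
  have hI : ∀ x, x ∈ I ↔ toR2 x ∈ interior Δ := fun x => by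
    rw [hIdef, Set.Finite.mem_toFinset]; rfl
  have hIcoe : intPts Δ = (I : Set (ℤ × ℤ)) := by rw [hIdef, Set.Finite.coe_toFinset]
  have hAcoe : latticePts Δ = (A : Set (ℤ × ℤ)) := by rw [hAdef, Set.Finite.coe_toFinset]
  have hΔ : Δ = convexHull ℝ (toR2 '' (A : Set (ℤ × ℤ))) := by
    apply Set.Subset.antisymm
    · conv_lhs => rw [hS]
      refine convexHull_mono (Set.image_mono fun x hx => (hA x).2 ?_)
      rw [hS]
      exact subset_convexHull ℝ _ ⟨x, hx, rfl⟩
    · refine convexHull_min ?_ hconv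
      rintro _ ⟨x, hx, rfl⟩
      exact (hA x).1 hx
  have hnc : ¬ Collinear ℝ (toR2 '' (I : Set (ℤ × ℤ))) := hIcoe ▸ hnh
  have H := interiorPair_of_convex hconv hA hI hΔ hnc
  have hbA : bdPts Δ = rim A := by
    have hne : (interior Δ).Nonempty := by
      obtain ⟨i, hi⟩ := H.nonempty
      exact ⟨_, (hI i).1 hi⟩
    have := bdPts_convexHull (A := A)
    rw [← hΔ] at this
    exact this hAcoe hne
  have hbI : bdPts (interiorHull Δ) = rim I := by
    unfold interiorHull
    rw [hIcoe]
    refine bdPts_convexHull (Set.Subset.antisymm (fun x hx => (hI x).2 ?_)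
      fun x hx => subset_convexHull ℝ _ ⟨x, hx, rfl⟩) (interior_convexHull_nonempty hnc)
    refine convexHull_min ?_ hconv.interior hx
    rintro _ ⟨y, hy, rfl⟩
    exact (hI y).1 hy
  rw [hbA, hbI, Set.ncard_coe_finset, Set.ncard_coe_finset, H.card_rim_eq_add_nine_iff]
  constructor
  · rintro ⟨u, v, h, hu, hv, hw, g1, g2, g3⟩
    exact exists_polytopeEquiv_stdSimplexD H hΔ h hu hv hw g1 g2 g3
  · rintro ⟨d, hd, he⟩
    exact exists_triple_of_polytopeEquiv hd hA hI he
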